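/- Given integers N ≥ 1 and a real number d > 1, there exists a constant B = B(N,d) > 1 with the following property: for every multicritical circle map f with irrational rotation number having at most N critical points, all of whose criticalities are at most d, there exists n₀ = n₀(f) ∈ ℕ such that for all n ≥ n₀, every atom Δ of the n-th dynamical partition P_n, and every k ∈ ℕ such that f^j(Δ) is contained in some element of P_n for all 1 ≤ j ≤ k, one has CrD(f^k; Δ, Δ*) ≤ B. (In fact one may take B = (3/2)^{2(3N+1)} (9d²)^{3N}.) -/

import Mathlib

open Set Filter Topology
open scoped ENNReal

noncomputable section

namespace MCircle

/-- A lift of an orientation-preserving `C³` circle homeomorphism of `S¹ = ℝ/ℤ`: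
a `C³`, strictly increasing map commuting with the unit translation. -/
structure IsCircleMapLift (f : ℝ → ℝ) : Prop where
  smooth : ContDiff ℝ 3 f
  mono : StrictMono f
  periodic : ∀ x : ℝ, f (x + 1) = f x + 1

/-- `c` is a non-flat (power-law) critical point of `f` of criticality `d > 1`:
near `c` we have `f x = f c + φ x * |φ x| ^ (d - 1)` for a `C³` diffeomorphism `φ`
of a neighbourhood `W` of `c` with `φ c = 0`. -/
def IsNonFlatCritPt (f : ℝ → ℝ) (c d : ℝ) : Prop :=
  1 < d ∧ ∃ (W : Set ℝ) (φ : ℝ → ℝ), IsOpen W ∧ c ∈ W ∧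
    ContDiffOn ℝ 3 φ W ∧ φ c = 0 ∧ (∀ x ∈ W, deriv φ x ≠ 0) ∧ InjOn φ W ∧
    ∀ x ∈ W, f x = f c + φ x * |φ x| ^ (d - 1)

/-- `f` is (a lift of) a multicritical circle map: the set of critical points of the
induced circle map, represented in `[0,1)`, is the nonempty finite set `C`, and each
critical point `c ∈ C` is non-flat of criticality `dc c`. -/
def IsMulticriticalLift (f : ℝ → ℝ) (C : Finset ℝ) (dc : ℝ → ℝ) : Prop :=
  IsCircleMapLift f ∧ C.Nonempty ∧ (↑C : Set ℝ) ⊆ Ico (0 : ℝ) 1 ∧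
    (∀ x : ℝ, deriv f x = 0 ↔ ∃ c ∈ C, ∃ k : ℤ, x = c + (k : ℝ)) ∧
    ∀ c ∈ C, IsNonFlatCritPt f c (dc c)

/-- The lift `f` has (translation) rotation number `ρ`. -/
def HasRotNumber (f : ℝ → ℝ) (ρ : ℝ) : Prop :=
  Tendsto (fun n : ℕ => f^[n] 0 / (n : ℝ)) atTop (𝓝 ρ)

/-- `f` is (a lift of) a multicritical circle map with critical set `C` (criticalities
`dc`) and irrational rotation number `ρ`, the lift being normalized so that `ρ ∈ (0,1)`. -/
def GoodMap (f : ℝ → ℝ) (C : Finset ℝ) (dc : ℝ → ℝ) (ρ : ℝ) : Prop :=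
  IsMulticriticalLift f C dc ∧ HasRotNumber f ρ ∧ Irrational ρ ∧ ρ ∈ Ioo (0 : ℝ) 1

/-- The Gauss map. -/
def gaussMap (x : ℝ) : ℝ := Int.fract x⁻¹

/-- The partial quotients `aₙ` of the continued fraction expansion
`ρ = [a₀, a₁, …] = 1/(a₀ + 1/(a₁ + ⋯))`. -/
def cfA (ρ : ℝ) (n : ℕ) : ℕ := ⌊(gaussMap^[n] (Int.fract ρ))⁻¹⌋₊

/-- The denominators `qₙ` of the convergents of `ρ` (the return times):
`q₀ = 1`, `q₁ = a₀`, `q_{n+2} = a_{n+1} q_{n+1} + qₙ`. -/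
def qden (ρ : ℝ) : ℕ → ℕ
  | 0 => 1
  | 1 => cfA ρ 0
  | n + 2 => cfA ρ (n + 1) * qden ρ (n + 1) + qden ρ n

/-- The numerators `pₙ` of the convergents of `ρ`:
`p₀ = 0`, `p₁ = 1`, `p_{n+2} = a_{n+1} p_{n+1} + pₙ`. -/
def pnum (ρ : ℝ) : ℕ → ℕ
  | 0 => 0
  | 1 => 1
  | n + 2 => cfA ρ (n + 1) * pnum ρ (n + 1) + pnum ρ n

/-- The lift representative of the `n`-th closest return `f^{qₙ}(x)`,
normalized (by the integer `pₙ`) to lie at distance less than one from `x`. -/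
def retPt (f : ℝ → ℝ) (ρ x : ℝ) (n : ℕ) : ℝ := f^[qden ρ n] x - (pnum ρ n : ℝ)

/-- The arc `Iₙ(x)`, with endpoints `x` and `f^{qₙ}(x)` and containing `f^{q_{n+2}}(x)`,
realized as an interval in the lift. -/
def arcI (f : ℝ → ℝ) (ρ x : ℝ) (n : ℕ) : Set ℝ := uIcc x (retPt f ρ x n)

/-- The length `|Iₙ(x)|`. -/
def arcLen (f : ℝ → ℝ) (ρ x : ℝ) (n : ℕ) : ℝ := |retPt f ρ x n - x|

/-- The length `|f^j(Iₙ(x))|`. -/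
def arcImgLen (f : ℝ → ℝ) (ρ x : ℝ) (n j : ℕ) : ℝ :=
  |f^[j] (retPt f ρ x n) - f^[j] x|

/-- Indices for the atoms of the `n`-th dynamical partition
`𝒫ₙ(x) = {fⁱ(Iₙ(x)) : 0 ≤ i ≤ q_{n+1}-1} ∪ {f^j(I_{n+1}(x)) : 0 ≤ j ≤ qₙ-1}`. -/
abbrev AtomIdx (ρ : ℝ) (n : ℕ) : Type :=
  {i : ℕ // i < qden ρ (n + 1)} ⊕ {j : ℕ // j < qden ρ n}

/-- Left endpoint (in the lift) of an atom of `𝒫ₙ(x)`. -/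
def atomL (f : ℝ → ℝ) (ρ x : ℝ) (n : ℕ) : AtomIdx ρ n → ℝ
  | Sum.inl i => min (f^[i.1] x) (f^[i.1] (retPt f ρ x n))
  | Sum.inr j => min (f^[j.1] x) (f^[j.1] (retPt f ρ x (n + 1)))

/-- Right endpoint (in the lift) of an atom of `𝒫ₙ(x)`. -/
def atomR (f : ℝ → ℝ) (ρ x : ℝ) (n : ℕ) : AtomIdx ρ n → ℝ
  | Sum.inl i => max (f^[i.1] x) (f^[i.1] (retPt f ρ x n))
  | Sum.inr j => max (f^[j.1] x) (f^[j.1] (retPt f ρ x (n + 1)))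

/-- Length of an atom of `𝒫ₙ(x)`. -/
def atomLen (f : ℝ → ℝ) (ρ x : ℝ) (n : ℕ) (A : AtomIdx ρ n) : ℝ :=
  atomR f ρ x n A - atomL f ρ x n A

/-- Two lift points represent the same point of the circle `ℝ/ℤ`. -/
def SameCirclePt (a b : ℝ) : Prop := ∃ m : ℤ, a = b + (m : ℝ)

/-- Two atoms of `𝒫ₙ(x)` are adjacent: they are distinct and share an endpoint
on the circle. -/
def AdjacentAtoms (f : ℝ → ℝ) (ρ x : ℝ) (n : ℕ) (A B : AtomIdx ρ n) : Prop :=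
  A ≠ B ∧ ∃ p ∈ ({atomL f ρ x n A, atomR f ρ x n A} : Set ℝ),
    ∃ q ∈ ({atomL f ρ x n B, atomR f ρ x n B} : Set ℝ), SameCirclePt p q

/-- `A` is the left neighbour of `Δ` in `𝒫ₙ(x)`. -/
def IsLeftNbr (f : ℝ → ℝ) (ρ x : ℝ) (n : ℕ) (A Δ : AtomIdx ρ n) : Prop :=
  A ≠ Δ ∧ SameCirclePt (atomR f ρ x n A) (atomL f ρ x n Δ)

/-- `B` is the right neighbour of `Δ` in `𝒫ₙ(x)`. -/
def IsRightNbr (f : ℝ → ℝ) (ρ x : ℝ) (n : ℕ) (B Δ : AtomIdx ρ n) : Prop :=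
  B ≠ Δ ∧ SameCirclePt (atomL f ρ x n B) (atomR f ρ x n Δ)

/-- The arc `f^j(Δ)` is contained (as a circle arc) in some element of `𝒫ₙ(x)`. -/
def ImgInAtom (f : ℝ → ℝ) (ρ x : ℝ) (n j : ℕ) (Δ : AtomIdx ρ n) : Prop :=
  ∃ E : AtomIdx ρ n, ∃ m : ℤ,
    atomL f ρ x n E + (m : ℝ) ≤ f^[j] (atomL f ρ x n Δ) ∧
    f^[j] (atomR f ρ x n Δ) ≤ atomR f ρ x n E + (m : ℝ)

/-- An atom of `𝒫ₙ(x)` as a subset of the circle `ℝ/ℤ`. -/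
def atomSetC (f : ℝ → ℝ) (ρ x : ℝ) (n : ℕ) (A : AtomIdx ρ n) : Set (AddCircle (1 : ℝ)) :=
  (fun y : ℝ => (y : AddCircle (1 : ℝ))) '' Icc (atomL f ρ x n A) (atomR f ρ x n A)

/-- The interval `Tₙ = I_{n+1} ∪ Iₙ ∪ f^{qₙ}(Iₙ)`, realized in the lift. -/
def Tset (f : ℝ → ℝ) (ρ x : ℝ) (n : ℕ) : Set ℝ :=
  arcI f ρ x (n + 1) ∪ arcI f ρ x n ∪
    (fun z => f^[qden ρ n] z - (pnum ρ n : ℝ)) '' arcI f ρ x n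

/-- `j` is a critical time: `f^j(Tₙ)` contains a critical point of `f` (mod 1). -/
def IsCritTime (f : ℝ → ℝ) (ρ x : ℝ) (C : Finset ℝ) (n j : ℕ) : Prop :=
  ∃ c ∈ C, ∃ m : ℤ, c + (m : ℝ) ∈ f^[j] '' Tset f ρ x n

/-- The cross-ratio `[M,T] = |L||R|/(|L∪M||M∪R|)` of the configuration
`M = [b,c] ⋐ T = [a,d]` (so `L = [a,b]`, `R = [c,d]`). -/
def crossRatio (a b c d : ℝ) : ℝ := ((b - a) * (d - c)) / ((c - a) * (d - b))

/-- The cross-ratio distortion `CrD(g; M, T)` of `g` on the configuration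
`M = [b,c] ⋐ T = [a,d]`. -/
def crD (g : ℝ → ℝ) (a b c d : ℝ) : ℝ :=
  crossRatio (g a) (g b) (g c) (g d) / crossRatio a b c d

/-- The Schwarzian derivative `Sg = g'''/g' - (3/2)(g''/g')²`. -/
def schwarzian (g : ℝ → ℝ) (x : ℝ) : ℝ :=
  iteratedDeriv 3 g x / deriv g x - (3 / 2) * (iteratedDeriv 2 g x / deriv g x) ^ 2

/-- `g` is a diffeomorphism on `S` with distortion bounded by `K`. -/
def DiffeoWithDistortionLE (g : ℝ → ℝ) (S : Set ℝ) (K : ℝ) : Prop :=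
  ContDiffOn ℝ 1 g S ∧ InjOn g S ∧ (∀ x ∈ S, deriv g x ≠ 0) ∧
    ∀ x ∈ S, ∀ y ∈ S, |deriv g x| ≤ K * |deriv g y|

/-- `g` is a diffeomorphism on `S` with negative Schwarzian derivative. -/
def NegSchwarzDiffeoOn (g : ℝ → ℝ) (S : Set ℝ) : Prop :=
  ContDiffOn ℝ 3 g S ∧ InjOn g S ∧ ∀ x ∈ S, deriv g x ≠ 0 ∧ schwarzian g x < 0

/-- The local quasi-symmetric distortion
`σ_h(x) = lim_{δ→0} limsup_{|t|≤δ} |h(x+t)-h(x)|/|h(x)-h(x-t)|` of a circle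
homeomorphism lift `h`, with values in `[0,∞]`. -/
def qsDistortion (h : ℝ → ℝ) (x : ℝ) : ℝ≥0∞ :=
  Filter.limsup
    (fun t : ℝ => ENNReal.ofReal (|h (x + t) - h x| / |h x - h (x - t)|))
    (𝓝[≠] (0 : ℝ))

end MCircle

open MCircle

namespace MCircle

/-! ### Cross-ratio distortion -/

lemma crD_eq_slope (g : ℝ → ℝ) (a b c e : ℝ) :
    crD g a b c e = (slope g a b * slope g c e) / (slope g a c * slope g b e) := by
  simp only [crD, crossRatio, slope_def_field, div_eq_mul_inv, mul_inv, inv_inv]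
  ring

lemma crossRatio_pos {a b c e : ℝ} (hab : a < b) (hbc : b < c) (hce : c < e) :
    0 < crossRatio a b c e := by
  have h1 : 0 < b - a := by linarith
  have h2 : 0 < e - c := by linarith
  have h3 : 0 < c - a := by linarith
  have h4 : 0 < e - b := by linarith
  unfold crossRatio
  positivity

lemma crossRatio_le_one {a b c e : ℝ} (hab : a < b) (hbc : b < c) (hce : c < e) :
    crossRatio a b c e ≤ 1 := by
  unfold crossRatio
  rw [div_le_one (mul_pos (by linarith) (by linarith))]
  exact mul_le_mul (by linarith) (by linarith) (by linarith) (by linarith)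

/-- Enlarging the outer interval enlarges the cross-ratio. -/
lemma crossRatio_mono {a a' b c e e' : ℝ} (haa : a' ≤ a) (hab : a < b) (hbc : b < c) (hce : c < e)
    (hee : e ≤ e') : crossRatio a b c e ≤ crossRatio a' b c e' := by
  unfold crossRatio
  rw [mul_div_mul_comm, mul_div_mul_comm]
  refine mul_le_mul ?_ ?_ (div_nonneg (by linarith) (by linarith))
    (div_nonneg (by linarith) (by linarith))
  · rw [div_le_div_iff₀ (by linarith) (by linarith)]
    nlinarith
  · rw [div_le_div_iff₀ (by linarith) (by linarith)]
    nlinarith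

lemma quarter_le_crossRatio {a b c e : ℝ} (hbc : b < c) (hL : c - b ≤ b - a)
    (hR : c - b ≤ e - c) : 1 / 4 ≤ crossRatio a b c e := by
  unfold crossRatio
  rw [div_le_div_iff₀ (by norm_num) (mul_pos (by linarith) (by linarith))]
  have h1 : c - a ≤ 2 * (b - a) := by linarith
  have h2 : e - b ≤ 2 * (e - c) := by linarith
  have := mul_le_mul h1 h2 (by linarith) (by linarith)
  linarith

lemma crD_pos {g : ℝ → ℝ} (hg : StrictMono g) {a b c e : ℝ} (hab : a < b) (hbc : b < c)
    (hce : c < e) : 0 < crD g a b c e :=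
  div_pos (crossRatio_pos (hg hab) (hg hbc) (hg hce)) (crossRatio_pos hab hbc hce)

lemma crD_comp (g h : ℝ → ℝ) {a b c e : ℝ} (h0 : crossRatio (h a) (h b) (h c) (h e) ≠ 0) :
    crD (g ∘ h) a b c e = crD g (h a) (h b) (h c) (h e) * crD h a b c e := by
  simp only [crD, Function.comp_apply]
  rw [div_mul_div_cancel₀ h0]

lemma crD_iterate {f : ℝ → ℝ} (hf : StrictMono f) {a b c e : ℝ} (hab : a < b) (hbc : b < c)
    (hce : c < e) (k : ℕ) :
    crD (f^[k]) a b c e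
      = ∏ j ∈ Finset.range k, crD f (f^[j] a) (f^[j] b) (f^[j] c) (f^[j] e) := by
  induction k with
  | zero => simp [crD, div_self (crossRatio_pos hab hbc hce).ne']
  | succ k ih =>
    have hk := hf.iterate k
    rw [Finset.prod_range_succ, ← ih, Function.iterate_succ',
      crD_comp _ _ (crossRatio_pos (hk hab) (hk hbc) (hk hce)).ne', mul_comm]

lemma crD_congr {g h : ℝ → ℝ} {a b c e : ℝ} (ha : g a = h a) (hb : g b = h b) (hc : g c = h c)
    (he : g e = h e) : crD g a b c e = crD h a b c e := by
  simp only [crD, ha, hb, hc, he]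

lemma crD_add_const (g : ℝ → ℝ) (k a b c e : ℝ) :
    crD (fun x => k + g x) a b c e = crD g a b c e := by
  simp only [crD, crossRatio, add_sub_add_left_eq_sub]

lemma crD_shift {g : ℝ → ℝ} {m : ℝ} (hg : ∀ x, g (x + m) = g x + m) (a b c e : ℝ) :
    crD g (a + m) (b + m) (c + m) (e + m) = crD g a b c e := by
  simp only [crD, crossRatio, hg, add_sub_add_right_eq_sub]

lemma crD_neg {g : ℝ → ℝ} (hg : ∀ x, g (-x) = -g x) (a b c e : ℝ) :
    crD g (-e) (-c) (-b) (-a) = crD g a b c e := by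
  simp only [crD, crossRatio, hg]
  congr 1 <;> congr 1 <;> ring

/-- Controlling the slopes on the side intervals controls the cross-ratio distortion. -/
lemma crD_le_mul {g : ℝ → ℝ} {a b c e K₁ K₂ : ℝ} (h1 : 0 < slope g a c) (h2 : 0 < slope g b e)
    (h3 : 0 ≤ slope g c e) (hK : 0 ≤ K₁)
    (hL : slope g a b ≤ K₁ * slope g a c) (hR : slope g c e ≤ K₂ * slope g b e) :
    crD g a b c e ≤ K₁ * K₂ := by
  rw [crD_eq_slope, div_le_iff₀ (mul_pos h1 h2)]
  calc slope g a b * slope g c e ≤ (K₁ * slope g a c) * (K₂ * slope g b e) :=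
        mul_le_mul hL hR h3 (mul_nonneg hK h1.le)
    _ = K₁ * K₂ * (slope g a c * slope g b e) := by ring

lemma slope_pos_of_lt {g : ℝ → ℝ} {x y : ℝ} (hxy : x < y) (h : g x < g y) : 0 < slope g x y := by
  rw [slope_def_field]
  exact div_pos (by linarith) (by linarith)

/-! ### The signed power map -/

/-- The odd power map `x ↦ x |x|^{d-1}`. -/
def signedPow (d x : ℝ) : ℝ := x * |x| ^ (d - 1)

lemma signedPow_neg (d x : ℝ) : signedPow d (-x) = -signedPow d x := by
  simp [signedPow]

lemma signedPow_of_nonneg {d x : ℝ} (hx : 0 ≤ x) : signedPow d x = x * x ^ (d - 1) := by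
  rw [signedPow, abs_of_nonneg hx]

lemma rpow_sub_one_mono {d x y : ℝ} (hd : 1 < d) (hx : 0 ≤ x) (hxy : x ≤ y) :
    x ^ (d - 1) ≤ y ^ (d - 1) :=
  Real.rpow_le_rpow hx hxy (by linarith)

lemma signedPow_sub_ge_of_nonneg {d x y : ℝ} (hd : 1 < d) (hx : 0 ≤ x) (hxy : x ≤ y) :
    y ^ (d - 1) * (y - x) ≤ signedPow d y - signedPow d x := by
  rw [signedPow_of_nonneg hx, signedPow_of_nonneg (hx.trans hxy)]
  nlinarith [rpow_sub_one_mono hd hx hxy]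

lemma signedPow_sub_le_of_nonneg {d x y : ℝ} (hd : 1 < d) (hx : 0 ≤ x) (hxy : x < y) :
    signedPow d y - signedPow d x ≤ d * y ^ (d - 1) * (y - x) := by
  have hy : 0 < y := by linarith
  have hB := one_add_mul_self_le_rpow_one_add (s := x / y - 1) (by
    have : 0 ≤ x / y := by positivity
    linarith) hd.le
  rw [add_sub_cancel, Real.div_rpow hx hy.le, le_div_iff₀ (by positivity)] at hB
  have e1 : y ^ d = y * y ^ (d - 1) := by
    rw [← Real.rpow_one_add' hy.le (by linarith)]; ring_nf
  have e2 : x ^ d = x * x ^ (d - 1) := by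
    rw [← Real.rpow_one_add' hx (by linarith)]; ring_nf
  rw [e1, e2] at hB
  rw [signedPow_of_nonneg hx, signedPow_of_nonneg hy.le]
  have e3 : (1 + d * (x / y - 1)) * (y * y ^ (d - 1))
      = y * y ^ (d - 1) + d * (x - y) * y ^ (d - 1) := by field_simp
  rw [e3] at hB
  linarith

lemma signedPow_strictMono {d : ℝ} (hd : 1 < d) : StrictMono (signedPow d) := by
  have hpos : ∀ x, 0 < x → 0 < signedPow d x := fun x hx => by
    rw [signedPow_of_nonneg hx.le]; positivity
  have hnn : ∀ x y, 0 ≤ x → x < y → signedPow d x < signedPow d y := fun x y hx hxy => by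
    have := signedPow_sub_ge_of_nonneg hd hx hxy.le
    have h2 : 0 < y ^ (d - 1) * (y - x) :=
      mul_pos (Real.rpow_pos_of_pos (by linarith) _) (by linarith)
    linarith
  intro x y hxy
  rcases le_or_gt 0 x with hx | hx
  · exact hnn x y hx hxy
  rcases le_or_gt y 0 with hy | hy
  · have := hnn (-y) (-x) (by linarith) (by linarith)
    rw [signedPow_neg, signedPow_neg] at this
    linarith
  · have h1 := hpos (-x) (by linarith)
    rw [signedPow_neg] at h1
    linarith [hpos y hy]

/-- Slope bounds for the signed power on an interval on one side of the critical point. -/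
lemma slope_signedPow_one_side {d x y : ℝ} (hd : 1 < d) (hxy : x < y) (h : 0 ≤ x ∨ y ≤ 0) :
    max |x| |y| ^ (d - 1) ≤ slope (signedPow d) x y ∧
      slope (signedPow d) x y ≤ d * max |x| |y| ^ (d - 1) := by
  have key : ∀ x y : ℝ, 0 ≤ x → x < y → max |x| |y| ^ (d - 1) ≤ slope (signedPow d) x y ∧
      slope (signedPow d) x y ≤ d * max |x| |y| ^ (d - 1) := by
    intro x y hx hxy
    rw [abs_of_nonneg hx, abs_of_nonneg (by linarith : 0 ≤ y), max_eq_right hxy.le,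
      slope_def_field, le_div_iff₀ (by linarith), div_le_iff₀ (by linarith)]
    exact ⟨signedPow_sub_ge_of_nonneg hd hx hxy.le, signedPow_sub_le_of_nonneg hd hx hxy⟩
  rcases h with h | h
  · exact key x y h hxy
  · have := key (-y) (-x) (by linarith) (by linarith)
    rw [abs_neg, abs_neg, max_comm] at this
    have e : slope (signedPow d) (-y) (-x) = slope (signedPow d) x y := by
      rw [slope_def_field, slope_def_field, signedPow_neg, signedPow_neg]
      congr 1 <;> ring
    rwa [e] at this

/-- Slope bounds for the signed power on an interval containing the critical point. -/
lemma slope_signedPow_straddle {d x y : ℝ} (hd : 1 < d) (hxy : x < y) (hx : x ≤ 0) (hy : 0 ≤ y) :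
    max |x| |y| ^ (d - 1) ≤ 2 * slope (signedPow d) x y ∧
      slope (signedPow d) x y ≤ max |x| |y| ^ (d - 1) := by
  have hyx : 0 < y - x := by linarith
  have e : signedPow d y - signedPow d x = |y| * |y| ^ (d - 1) + |x| * |x| ^ (d - 1) := by
    rw [signedPow, signedPow, abs_of_nonneg hy, abs_of_nonpos hx]; ring
  have e' : y - x = |y| + |x| := by rw [abs_of_nonneg hy, abs_of_nonpos hx]; ring
  rw [slope_def_field, ← mul_div_assoc, le_div_iff₀ hyx, div_le_iff₀ hyx, e, e']
  have h0 := abs_nonneg x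
  have h1 := abs_nonneg y
  have hx' : 0 ≤ |x| ^ (d - 1) := by positivity
  have hy' : 0 ≤ |y| ^ (d - 1) := by positivity
  rcases le_total |x| |y| with h | h
  · rw [max_eq_right h]
    have := rpow_sub_one_mono hd h0 h
    constructor <;> nlinarith
  · rw [max_eq_left h]
    have := rpow_sub_one_mono hd h1 h
    constructor <;> nlinarith

lemma slope_signedPow_bounds {d x y : ℝ} (hd : 1 < d) (hxy : x < y) :
    max |x| |y| ^ (d - 1) ≤ 2 * slope (signedPow d) x y ∧
      slope (signedPow d) x y ≤ d * max |x| |y| ^ (d - 1) := by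
  have hm : 0 ≤ max |x| |y| ^ (d - 1) := by positivity
  by_cases h : 0 ≤ x ∨ y ≤ 0
  · have := slope_signedPow_one_side hd hxy h
    exact ⟨by linarith, this.2⟩
  · push Not at h
    have := slope_signedPow_straddle hd hxy h.1.le h.2.le
    exact ⟨this.1, this.2.trans (le_mul_of_one_le_left hm hd.le)⟩

lemma max_abs_mono {x y x' y' : ℝ} (h1 : x' ≤ x) (h2 : x ≤ y) (h3 : y ≤ y') :
    max |x| |y| ≤ max |x'| |y'| := by
  have := abs_le_max_abs_abs (h1.trans le_rfl) (h2.trans h3)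
  have := abs_le_max_abs_abs (h1.trans h2) h3
  exact max_le ‹_› ‹_›

/-- The slope of the signed power on an interval is at most `2d` times its slope on any larger
interval. -/
lemma slope_signedPow_le {d x y x' y' : ℝ} (hd : 1 < d) (h1 : x' ≤ x) (h2 : x < y) (h3 : y ≤ y') :
    slope (signedPow d) x y ≤ 2 * d * slope (signedPow d) x' y' := by
  have a1 := (slope_signedPow_bounds hd h2).2
  have a2 := (slope_signedPow_bounds hd (h1.trans_lt (h2.trans_le h3))).1
  have := rpow_sub_one_mono hd (by positivity) (max_abs_mono h1 h2.le h3)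
  nlinarith

lemma slope_signedPow_pos {d x y : ℝ} (hd : 1 < d) (h : x < y) : 0 < slope (signedPow d) x y :=
  slope_pos_of_lt h (signedPow_strictMono hd h)

lemma crD_signedPow_le {d a b c e : ℝ} (hd : 1 < d) (hab : a < b) (hbc : b < c) (hce : c < e) :
    crD (signedPow d) a b c e ≤ 4 * d ^ 2 := by
  refine (crD_le_mul (K₁ := 2 * d) (K₂ := 2 * d) (slope_signedPow_pos hd (hab.trans hbc))
    (slope_signedPow_pos hd (hbc.trans hce)) (slope_signedPow_pos hd hce).le (by linarith)
    (slope_signedPow_le hd le_rfl hab hbc.le) (slope_signedPow_le hd hbc.le hce le_rfl)).trans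
    (le_of_eq (by ring))

lemma crD_signedPow_le_of_left {d a b c e : ℝ} (hd : 1 < d) (ha : a ≤ 0) (hb : 0 ≤ b) (hab : a < b)
    (hbc : b < c) (hce : c < e) : crD (signedPow d) a b c e ≤ 2 * d := by
  refine crD_le_mul (slope_signedPow_pos hd (hab.trans hbc))
    (slope_signedPow_pos hd (hbc.trans hce)) (slope_signedPow_pos hd hce).le (by norm_num) ?_ ?_
  · have h1 := (slope_signedPow_straddle hd hab ha hb).2
    have h2 := (slope_signedPow_bounds hd (hab.trans hbc)).1
    have := rpow_sub_one_mono hd (by positivity) (max_abs_mono le_rfl hab.le hbc.le)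
    linarith
  · have h1 := (slope_signedPow_one_side hd hce (Or.inl (by linarith))).2
    have h2 := (slope_signedPow_one_side hd (hbc.trans hce) (Or.inl hb)).1
    have := rpow_sub_one_mono hd (by positivity) (max_abs_mono hbc.le hce.le le_rfl)
    nlinarith

lemma crD_signedPow_le_of_right {d a b c e : ℝ} (hd : 1 < d) (hc : c ≤ 0) (he : 0 ≤ e)
    (hab : a < b) (hbc : b < c) (hce : c < e) : crD (signedPow d) a b c e ≤ 2 * d := by
  rw [← crD_neg (signedPow_neg d)]
  exact crD_signedPow_le_of_left hd (by linarith) (by linarith) (by linarith) (by linarith)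
    (by linarith)

/-! ### The power map contracts cross-ratios away from its critical point -/

lemma sinh_mul_cosh_le {d t : ℝ} (hd : 1 < d) (ht : 0 ≤ t) :
    Real.sinh (d * t) * Real.cosh t ≤ d * Real.cosh (d * t) * Real.sinh t := by
  have hder : ∀ t : ℝ, HasDerivAt
      (fun t => d * Real.cosh (d * t) * Real.sinh t - Real.sinh (d * t) * Real.cosh t)
      ((d ^ 2 - 1) * (Real.sinh (d * t) * Real.sinh t)) t := by
    intro t
    have h1 : HasDerivAt (fun t : ℝ => d * t) d t := by
      simpa using (hasDerivAt_id t).const_mul d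
    have h2 := ((h1.cosh.const_mul d).mul (Real.hasDerivAt_sinh t)).sub
      (h1.sinh.mul (Real.hasDerivAt_cosh t))
    refine h2.congr_deriv ?_
    ring
  have hmono : MonotoneOn
      (fun t => d * Real.cosh (d * t) * Real.sinh t - Real.sinh (d * t) * Real.cosh t)
      (Ici 0) := by
    refine monotoneOn_of_deriv_nonneg (convex_Ici 0)
      (fun t _ => (hder t).continuousAt.continuousWithinAt)
      (fun t _ => (hder t).differentiableAt.differentiableWithinAt) ?_
    intro t ht
    rw [interior_Ici] at ht
    have ht : 0 < t := ht
    rw [(hder t).deriv]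
    have h1 : 0 ≤ Real.sinh (d * t) := Real.sinh_nonneg_iff.2 (by positivity)
    have h2 : 0 ≤ Real.sinh t := Real.sinh_nonneg_iff.2 ht.le
    have h3 : 0 ≤ d ^ 2 - 1 := by nlinarith
    positivity
  have := hmono (mem_Ici.2 le_rfl) ht ht
  simp only [mul_zero, Real.sinh_zero, zero_mul, sub_zero] at this
  linarith

lemma sinh_mul_div_sinh_mono {d s t : ℝ} (hd : 1 < d) (hs : 0 < s) (hst : s ≤ t) :
    Real.sinh (d * s) / Real.sinh s ≤ Real.sinh (d * t) / Real.sinh t := by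
  have hne : ∀ t ∈ Ioi (0 : ℝ), Real.sinh t ≠ 0 := fun t ht => (Real.sinh_pos_iff.2 ht).ne'
  have hder : ∀ t ∈ Ioi (0 : ℝ), HasDerivAt (fun t => Real.sinh (d * t) / Real.sinh t)
      ((Real.cosh (d * t) * d * Real.sinh t - Real.sinh (d * t) * Real.cosh t)
        / Real.sinh t ^ 2) t := by
    intro t ht
    have h1 : HasDerivAt (fun t : ℝ => d * t) d t := by
      simpa using (hasDerivAt_id t).const_mul d
    exact h1.sinh.div (Real.hasDerivAt_sinh t) (hne t ht)
  have hmono : MonotoneOn (fun t => Real.sinh (d * t) / Real.sinh t) (Ioi 0) := by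
    refine monotoneOn_of_deriv_nonneg (convex_Ioi 0)
      (fun t ht => (hder t ht).continuousAt.continuousWithinAt)
      (fun t ht => (hder t (interior_subset ht)).differentiableAt.differentiableWithinAt) ?_
    intro t ht
    rw [interior_Ioi] at ht
    rw [(hder t ht).deriv]
    have := sinh_mul_cosh_le hd (le_of_lt ht)
    exact div_nonneg (by linarith) (by positivity)
  exact hmono hs (hs.trans_le hst) hst

lemma slope_signedPow_exp {d u v : ℝ} :
    slope (signedPow d) (Real.exp u) (Real.exp v)
      = Real.exp ((d - 1) / 2 * u) * Real.exp ((d - 1) / 2 * v) *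
        (Real.sinh (d * ((v - u) / 2)) / Real.sinh ((v - u) / 2)) := by
  have e0 : ∀ w : ℝ, signedPow d (Real.exp w) = Real.exp (d * w) := by
    intro w
    rw [signedPow_of_nonneg (Real.exp_pos w).le, ← Real.exp_mul, ← Real.exp_add]
    ring_nf
  have e1 : ∀ r : ℝ, Real.exp (r * v) - Real.exp (r * u)
      = 2 * Real.exp (r * ((u + v) / 2)) * Real.sinh (r * ((v - u) / 2)) := by
    intro r
    rw [Real.sinh_eq]
    have a1 : Real.exp (r * v) = Real.exp (r * ((u + v) / 2)) * Real.exp (r * ((v - u) / 2)) := by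
      rw [← Real.exp_add]; ring_nf
    have a2 : Real.exp (r * u)
        = Real.exp (r * ((u + v) / 2)) * Real.exp (-(r * ((v - u) / 2))) := by
      rw [← Real.exp_add]; ring_nf
    rw [a1, a2]; ring
  have e2 := e1 1
  simp only [one_mul] at e2
  have e3 : Real.exp (d * ((u + v) / 2))
      = Real.exp ((u + v) / 2) * (Real.exp ((d - 1) / 2 * u) * Real.exp ((d - 1) / 2 * v)) := by
    rw [← Real.exp_add, ← Real.exp_add]; ring_nf
  rw [slope_def_field, e0, e0, e1 d, e2, e3]
  have := Real.exp_pos ((u + v) / 2)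
  rw [show 2 * (Real.exp ((u + v) / 2) * (Real.exp ((d - 1) / 2 * u) * Real.exp ((d - 1) / 2 * v)))
      * Real.sinh (d * ((v - u) / 2)) = (2 * Real.exp ((u + v) / 2)) *
      ((Real.exp ((d - 1) / 2 * u) * Real.exp ((d - 1) / 2 * v)) * Real.sinh (d * ((v - u) / 2)))
      by ring, mul_div_mul_left _ _ (by positivity), mul_div_assoc]

lemma crD_signedPow_le_one_of_pos {d a b c e : ℝ} (hd : 1 < d) (ha : 0 < a) (hab : a < b)
    (hbc : b < c) (hce : c < e) : crD (signedPow d) a b c e ≤ 1 := by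
  have hb := ha.trans hab
  have hc := hb.trans hbc
  have he := hc.trans hce
  have l1 := Real.log_lt_log ha hab
  have l2 := Real.log_lt_log hb hbc
  have l3 := Real.log_lt_log hc hce
  have p1 := slope_signedPow_pos hd (hab.trans hbc)
  have p2 := slope_signedPow_pos hd (hbc.trans hce)
  rw [crD_eq_slope, div_le_one (mul_pos p1 p2)]
  rw [← Real.exp_log ha, ← Real.exp_log hb, ← Real.exp_log hc, ← Real.exp_log he]
  simp only [slope_signedPow_exp]
  have m1 := sinh_mul_div_sinh_mono hd (s := (Real.log b - Real.log a) / 2)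
    (t := (Real.log c - Real.log a) / 2) (by linarith) (by linarith)
  have m2 := sinh_mul_div_sinh_mono hd (s := (Real.log e - Real.log c) / 2)
    (t := (Real.log e - Real.log b) / 2) (by linarith) (by linarith)
  have hnn : ∀ s : ℝ, 0 < s → 0 ≤ Real.sinh (d * s) / Real.sinh s := fun s hs =>
    div_nonneg (Real.sinh_nonneg_iff.2 (by positivity)) (Real.sinh_nonneg_iff.2 hs.le)
  have m3 := mul_le_mul m1 m2 (hnn _ (by linarith)) (hnn _ (by linarith))
  set A := Real.exp ((d - 1) / 2 * Real.log a)
  set B := Real.exp ((d - 1) / 2 * Real.log b)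
  set C := Real.exp ((d - 1) / 2 * Real.log c)
  set E := Real.exp ((d - 1) / 2 * Real.log e)
  have hp : 0 ≤ A * B * C * E := by positivity
  have := mul_le_mul_of_nonneg_left m3 hp
  calc _ = A * B * C * E * (Real.sinh (d * ((Real.log b - Real.log a) / 2)) /
          Real.sinh ((Real.log b - Real.log a) / 2) *
          (Real.sinh (d * ((Real.log e - Real.log c) / 2)) /
          Real.sinh ((Real.log e - Real.log c) / 2))) := by ring
    _ ≤ _ := this
    _ = _ := by ring

lemma continuous_signedPow {d : ℝ} (hd : 1 < d) : Continuous (signedPow d) := by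
  unfold signedPow
  exact continuous_id.mul (continuous_abs.rpow_const fun x => Or.inr (by linarith))

lemma crD_signedPow_le_one_of_nonneg {d a b c e : ℝ} (hd : 1 < d) (ha : 0 ≤ a) (hab : a < b)
    (hbc : b < c) (hce : c < e) : crD (signedPow d) a b c e ≤ 1 := by
  have hac := hab.trans hbc
  have hcont : ContinuousAt (fun t => crD (signedPow d) t b c e) a := by
    have hP := (continuous_signedPow hd).continuousAt (x := a)
    have hs := signedPow_strictMono hd
    unfold crD crossRatio
    refine ContinuousAt.div (ContinuousAt.div ?_ ?_ ?_) (ContinuousAt.div ?_ ?_ ?_) ?_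
    · exact (continuousAt_const.sub hP).mul continuousAt_const
    · exact (continuousAt_const.sub hP).mul continuousAt_const
    · exact mul_ne_zero (sub_ne_zero.2 (hs hac).ne') (sub_ne_zero.2 (hs (hbc.trans hce)).ne')
    · exact (continuousAt_const.sub continuousAt_id).mul continuousAt_const
    · exact (continuousAt_const.sub continuousAt_id).mul continuousAt_const
    · exact mul_ne_zero (sub_ne_zero.2 hac.ne') (sub_ne_zero.2 (hbc.trans hce).ne')
    · exact (crossRatio_pos hab hbc hce).ne'
  have hlim : Tendsto (fun t => crD (signedPow d) t b c e) (𝓝[>] a)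
      (𝓝 (crD (signedPow d) a b c e)) := hcont.tendsto.mono_left nhdsWithin_le_nhds
  refine le_of_tendsto hlim ?_
  filter_upwards [Ioo_mem_nhdsGT hab] with t ht
  exact crD_signedPow_le_one_of_pos hd (ha.trans_lt ht.1) ht.2 hbc hce

lemma crD_signedPow_le_one {d a b c e : ℝ} (hd : 1 < d) (h : 0 ≤ a ∨ e ≤ 0) (hab : a < b)
    (hbc : b < c) (hce : c < e) : crD (signedPow d) a b c e ≤ 1 := by
  rcases h with h | h
  · exact crD_signedPow_le_one_of_nonneg hd h hab hbc hce
  · rw [← crD_neg (signedPow_neg d)]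
    exact crD_signedPow_le_one_of_nonneg hd (by linarith) (by linarith) (by linarith) (by linarith)

/-! ### Cross-ratio distortion of a diffeomorphism on a small interval -/

lemma slope_taylor {g : ℝ → ℝ} {a h Λ : ℝ} (hΛ : 0 ≤ Λ)
    (hg : ∀ t ∈ Icc a (a + h), DifferentiableAt ℝ g t)
    (hg' : ∀ t ∈ Icc a (a + h), DifferentiableAt ℝ (deriv g) t)
    (hL : ∀ t ∈ Icc a (a + h), |deriv (deriv g) t - deriv (deriv g) a| ≤ Λ * |t - a|)
    {x y : ℝ} (hx : a ≤ x) (hxy : x < y) (hy : y ≤ a + h) :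
    |slope g x y - (deriv g a + deriv (deriv g) a * ((x + y) / 2 - a))| ≤ Λ * h ^ 2 := by
  have ha : a ∈ Icc a (a + h) := ⟨le_rfl, by linarith⟩
  have hh : 0 ≤ h := by linarith
  have h1 : ∀ t ∈ Icc a (a + h),
      |deriv g t - deriv g a - deriv (deriv g) a * (t - a)| ≤ Λ * h ^ 2 := by
    intro t ht
    have hd : ∀ s ∈ Icc a (a + h), HasDerivWithinAt
        (fun s => deriv g s - deriv (deriv g) a * s)
        (deriv (deriv g) s - deriv (deriv g) a) (Icc a (a + h)) s := by
      intro s hs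
      have := ((hg' s hs).hasDerivAt.sub ((hasDerivAt_id s).const_mul (deriv (deriv g) a)))
      exact (this.congr_deriv (by ring)).hasDerivWithinAt
    have hb : ∀ s ∈ Icc a (a + h), ‖deriv (deriv g) s - deriv (deriv g) a‖ ≤ Λ * h := by
      intro s hs
      refine (hL s hs).trans (mul_le_mul_of_nonneg_left ?_ hΛ)
      rw [abs_of_nonneg (by linarith [hs.1])]
      linarith [hs.2]
    have := (convex_Icc a (a + h)).norm_image_sub_le_of_norm_hasDerivWithin_le hd hb ha ht
    rw [Real.norm_eq_abs, Real.norm_eq_abs, abs_of_nonneg (by linarith [ht.1] : 0 ≤ t - a)] at this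
    have h2 : Λ * h * (t - a) ≤ Λ * h * h :=
      mul_le_mul_of_nonneg_left (by linarith [ht.2]) (by positivity)
    calc _ = |deriv g t - deriv (deriv g) a * t - (deriv g a - deriv (deriv g) a * a)| := by
          congr 1; ring
      _ ≤ _ := this
      _ ≤ _ := by linarith
  have hd : ∀ s ∈ Icc a (a + h), HasDerivWithinAt
      (fun s => g s - (deriv g a * s + deriv (deriv g) a / 2 * (s - a) ^ 2))
      (deriv g s - deriv g a - deriv (deriv g) a * (s - a)) (Icc a (a + h)) s := by
    intro s hs
    have e1 : HasDerivAt (fun s : ℝ => (s - a) ^ 2) (2 * (s - a)) s := by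
      exact (((hasDerivAt_id s).sub_const a).pow 2).congr_deriv (by simp)
    have := (hg s hs).hasDerivAt.sub (((hasDerivAt_id s).const_mul (deriv g a)).add
      (e1.const_mul (deriv (deriv g) a / 2)))
    refine (this.congr_deriv ?_).hasDerivWithinAt
    ring
  have := (convex_Icc a (a + h)).norm_image_sub_le_of_norm_hasDerivWithin_le hd h1
    ⟨hx, by linarith⟩ ⟨by linarith, hy⟩
  rw [Real.norm_eq_abs, Real.norm_eq_abs, abs_of_pos (by linarith : 0 < y - x),
    ← div_le_iff₀ (by linarith)] at this
  refine le_trans (le_of_eq ?_) this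
  have habs : ∀ u : ℝ, |u| / (y - x) = |u / (y - x)| := fun u => by
    rw [abs_div, abs_of_pos (by linarith : 0 < y - x)]
  have hne : y - x ≠ 0 := by linarith
  rw [habs, slope_def_field]
  congr 1
  field_simp
  ring

lemma mul_le_of_close {s₁ s₂ s₃ s₄ δ α β A B S : ℝ} (h1 : s₁ = s₃ + δ + α) (h2 : s₂ = s₄ - δ + β)
    (hδ : |δ * (s₄ - s₃)| ≤ A) (hα : |α| ≤ B) (hβ : |β| ≤ B) (hS1 : |s₁ - α| ≤ S)
    (hS2 : |s₂| ≤ S) : s₁ * s₂ ≤ s₃ * s₄ + (A + 2 * (B * S)) := by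
  have e : s₁ * s₂ = s₃ * s₄ + δ * (s₄ - s₃) - δ ^ 2 + α * s₂ + β * (s₁ - α) := by
    subst h1 h2; ring
  have hB : 0 ≤ B := (abs_nonneg _).trans hα
  have b1 : α * s₂ ≤ B * S := (le_abs_self _).trans (by
    rw [abs_mul]; exact mul_le_mul hα hS2 (abs_nonneg _) hB)
  have b2 : β * (s₁ - α) ≤ B * S := (le_abs_self _).trans (by
    rw [abs_mul]; exact mul_le_mul hβ hS1 (abs_nonneg _) hB)
  have b3 := (le_abs_self _).trans hδ
  rw [e]
  nlinarith [sq_nonneg δ]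

lemma mul_le_of_taylor {a b c e h p q Q Λ S s₁ s₂ s₃ s₄ : ℝ} (hab : a < b) (hbc : b < c)
    (hce : c < e) (hh : e - a = h) (hh1 : h ≤ 1) (hΛ : 0 ≤ Λ) (hq : |q| ≤ Q)
    (t1 : |s₁ - (p + q * ((a + b) / 2 - a))| ≤ Λ * h ^ 2)
    (t2 : |s₂ - (p + q * ((c + e) / 2 - a))| ≤ Λ * h ^ 2)
    (t3 : |s₃ - (p + q * ((a + c) / 2 - a))| ≤ Λ * h ^ 2)
    (t4 : |s₄ - (p + q * ((b + e) / 2 - a))| ≤ Λ * h ^ 2)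
    (p1 : 0 ≤ s₁) (p2 : 0 ≤ s₂) (q1 : s₁ ≤ S) (q2 : s₂ ≤ S) :
    s₁ * s₂ ≤ s₃ * s₄ +
      (Q * (Q + 2 * Λ) + 2 * (2 * Λ * (S + 2 * Λ))) * h ^ 2 := by
  have hh0 : 0 < h := by linarith
  have hQ0 : 0 ≤ Q := (abs_nonneg _).trans hq
  have hh2 : h ^ 2 ≤ h := by nlinarith
  have hΛh2 : Λ * h ^ 2 ≤ Λ * h := mul_le_mul_of_nonneg_left hh2 hΛ
  have hΛh : Λ * h ≤ Λ := mul_le_of_le_one_right hΛ hh1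
  have e1 : q * ((b - c) / 2) = q * ((a + b) / 2 - a) - q * ((a + c) / 2 - a) := by ring
  have e2 : q * ((b - c) / 2) = q * ((b + e) / 2 - a) - q * ((c + e) / 2 - a) := by ring
  have e3 : q * ((b + e - a - c) / 2) = q * ((b + e) / 2 - a) - q * ((a + c) / 2 - a) := by ring
  have hbc' : |(b - c) / 2| ≤ h := by rw [abs_le]; constructor <;> linarith
  have hm0 : |q * ((b + e - a - c) / 2)| ≤ Q * h := by
    rw [abs_mul]
    refine mul_le_mul hq ?_ (abs_nonneg _) hQ0
    rw [abs_le]; constructor <;> linarith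
  rw [abs_le] at t1 t2 t3 t4 hm0
  have key := mul_le_of_close (s₁ := s₁) (s₂ := s₂) (s₃ := s₃)
    (s₄ := s₄) (δ := q * ((b - c) / 2))
    (α := s₁ - s₃ - q * ((b - c) / 2))
    (β := s₂ - s₄ + q * ((b - c) / 2))
    (A := (Q * h) * ((Q + 2 * Λ) * h)) (B := 2 * Λ * h ^ 2) (S := S + 2 * Λ) (by ring) (by ring)
    (by
      rw [abs_mul, abs_mul]
      refine mul_le_mul (mul_le_mul hq hbc' (abs_nonneg _) hQ0) ?_ (abs_nonneg _) (by positivity)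
      rw [abs_le]
      constructor <;> linarith)
    (by rw [abs_le]; constructor <;> linarith)
    (by rw [abs_le]; constructor <;> linarith)
    (by rw [abs_le]; constructor <;> linarith)
    (by rw [abs_le]; constructor <;> linarith)
  linarith

/-- A `C³` map has cross-ratio distortion `1 + O(|T|²)` near a point where its derivative is
positive. -/
lemma exists_crD_le_exp {g : ℝ → ℝ} {x₀ η : ℝ} (hg : ContDiffAt ℝ 3 g x₀) (hpos : 0 < deriv g x₀)
    (hη : 0 < η) (hη1 : η < 1) :
    ∃ r > 0, ∃ C ≥ 0,
      (∀ x ∈ Metric.ball x₀ r, ∀ y ∈ Metric.ball x₀ r, x < y →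
        (1 - η) * deriv g x₀ ≤ slope g x y ∧ slope g x y ≤ (1 + η) * deriv g x₀) ∧
      ∀ a b c e : ℝ, a ∈ Metric.ball x₀ r → e ∈ Metric.ball x₀ r → a < b → b < c → c < e →
        crD g a b c e ≤ Real.exp (C * (e - a) ^ 2) := by
  set D := deriv g x₀ with hD
  have hg1 : ContDiffAt ℝ 2 (deriv g) x₀ := hg.derivWithin (by norm_num)
  have hg2 : ContDiffAt ℝ 1 (deriv (deriv g)) x₀ := hg1.derivWithin (by norm_num)
  obtain ⟨Λ, t, ht, hΛ⟩ := hg2.exists_lipschitzOnWith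
  have ev1 : ∀ᶠ y in 𝓝 x₀, DifferentiableAt ℝ g y :=
    (hg.eventually (by norm_num)).mono fun y hy => hy.differentiableAt (by norm_num)
  have ev2 : ∀ᶠ y in 𝓝 x₀, DifferentiableAt ℝ (deriv g) y :=
    (hg1.eventually (by norm_num)).mono fun y hy => hy.differentiableAt (by norm_num)
  have ev3 : ∀ᶠ y in 𝓝 x₀, deriv g y ∈ Icc ((1 - η) * D) ((1 + η) * D) :=
    hg1.continuousAt.eventually_mem (Icc_mem_nhds (by nlinarith) (by nlinarith))
  set Q := |deriv (deriv g) x₀| + 1 with hQ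
  have ev4 : ∀ᶠ y in 𝓝 x₀, |deriv (deriv g) y| < Q :=
    hg2.continuousAt.abs.eventually (gt_mem_nhds (by linarith))
  obtain ⟨r, hr, hball⟩ := Metric.eventually_nhds_iff_ball.1
    (ev1.and (ev2.and (ev3.and (ev4.and (eventually_mem_set.2 ht)))))
  have hQ0 : 0 ≤ Q := by positivity
  have hΛ0 : (0 : ℝ) ≤ Λ := Λ.2
  have hslope : ∀ x ∈ Metric.ball x₀ r, ∀ y ∈ Metric.ball x₀ r, x < y →
        (1 - η) * D ≤ slope g x y ∧ slope g x y ≤ (1 + η) * D := by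
    intro x hx y hy hxy
    have hsub : Icc x y ⊆ Metric.ball x₀ r := (convex_ball x₀ r).ordConnected.out hx hy
    obtain ⟨z, hz, hzs⟩ := exists_deriv_eq_slope g hxy
      (fun z hz => (hball z (hsub hz)).1.continuousAt.continuousWithinAt)
      (fun z hz => (hball z (hsub (Ioo_subset_Icc_self hz))).1.differentiableWithinAt)
    rw [slope_def_field, ← hzs]
    exact (hball z (hsub (Ioo_subset_Icc_self hz))).2.2.1
  set r' := min r (1 / 2) with hr'
  have hr'0 : 0 < r' := lt_min hr (by norm_num)
  set S := (1 + η) * D with hS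
  have hS0 : 0 ≤ S := by positivity
  set K := Q * (Q + 2 * Λ) + 2 * (2 * Λ * (S + 2 * Λ)) with hK
  have hK0 : 0 ≤ K := by positivity
  have hm : 0 < (1 - η) * D := mul_pos (by linarith) hpos
  refine ⟨r', hr'0, K / ((1 - η) * D) ^ 2, by positivity, ?_, ?_⟩
  · exact fun x hx y hy => hslope x (Metric.ball_subset_ball (min_le_left _ _) hx) y
      (Metric.ball_subset_ball (min_le_left _ _) hy)
  intro a b c e ha he hab hbc hce
  have hsub : Icc a e ⊆ Metric.ball x₀ r :=
    ((convex_ball x₀ r').ordConnected.out ha he).trans (Metric.ball_subset_ball (min_le_left _ _))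
  set h := e - a with hh
  have hh1 : h ≤ 1 := by
    have h1 := Metric.mem_ball.1 ha
    have h2 := Metric.mem_ball.1 he
    rw [Real.dist_eq, abs_lt] at h1 h2
    have := min_le_right r (1 / 2)
    linarith [h1.1, h2.2]
  have eah : a + h = e := by linarith
  have haI : a ∈ Icc a e := ⟨le_rfl, by linarith⟩
  have htay : ∀ x y, a ≤ x → x < y → y ≤ e →
      |slope g x y - (deriv g a + deriv (deriv g) a * ((x + y) / 2 - a))| ≤ Λ * h ^ 2 := by
    intro x y hx hxy hy
    refine slope_taylor hΛ0 ?_ ?_ ?_ hx hxy (by linarith) <;> rw [eah]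
    · exact fun z hz => (hball z (hsub hz)).1
    · exact fun z hz => (hball z (hsub hz)).2.1
    · intro z hz
      have := hΛ.dist_le_mul z (hball z (hsub hz)).2.2.2.2 a (hball a (hsub haI)).2.2.2.2
      simpa [Real.dist_eq] using this
  have hsl : ∀ x y, a ≤ x → x < y → y ≤ e →
      (1 - η) * D ≤ slope g x y ∧ slope g x y ≤ (1 + η) * D := fun x y hx hxy hy =>
    hslope x (hsub ⟨hx, by linarith⟩) y (hsub ⟨by linarith, hy⟩) hxy
  have q1 := hsl a b le_rfl hab (by linarith)
  have q2 := hsl c e (by linarith) hce le_rfl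
  have q3 := hsl a c le_rfl (by linarith) (by linarith)
  have q4 := hsl b e (by linarith) (by linarith) le_rfl
  have key := mul_le_of_taylor hab hbc hce hh.symm hh1 hΛ0 (hball a (hsub haI)).2.2.2.1.le
    (htay a b le_rfl hab (by linarith)) (htay c e (by linarith) hce le_rfl)
    (htay a c le_rfl (by linarith) (by linarith)) (htay b e (by linarith) (by linarith) le_rfl)
    (hm.le.trans q1.1) (hm.le.trans q2.1) q1.2 q2.2
  rw [← hK] at key
  have h34 : ((1 - η) * D) ^ 2 ≤ slope g a c * slope g b e := by
    rw [sq]; exact mul_le_mul q3.1 q4.1 hm.le (hm.le.trans q3.1)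
  have h34p : 0 < slope g a c * slope g b e := lt_of_lt_of_le (by positivity) h34
  calc crD g a b c e = (slope g a b * slope g c e) / (slope g a c * slope g b e) :=
        crD_eq_slope g a b c e
    _ ≤ (slope g a c * slope g b e + K * h ^ 2) / (slope g a c * slope g b e) := by gcongr
    _ = K * h ^ 2 / (slope g a c * slope g b e) + 1 := by
        rw [add_div, div_self h34p.ne', add_comm]
    _ ≤ K * h ^ 2 / ((1 - η) * D) ^ 2 + 1 := by gcongr
    _ = K / ((1 - η) * D) ^ 2 * h ^ 2 + 1 := by ring
    _ ≤ _ := Real.add_one_le_exp _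

/-! ### One-step bounds for a multicritical circle map -/

/-- Bounds for the one-step cross-ratio distortion of `f` on the configuration `a < b < c < e`,
according to the position of the critical points. -/
structure StepBound (f : ℝ → ℝ) (d C a b c e : ℝ) : Prop where
  noncrit : (∀ x ∈ Ioo a e, deriv f x ≠ 0) → crD f a b c e ≤ Real.exp (C * (e - a) ^ 2)
  mid : ∀ x ∈ Ioo b c, deriv f x = 0 → crD f a b c e ≤ 9 * d ^ 2
  side : ∀ x ∈ Ioc a b ∪ Ico c e, deriv f x = 0 → crD f a b c e ≤ 3 * d

/-- The slopes of `f` on `[x, y]` and `[y, z]` are controlled by its slope on `[x, z]`. -/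
def SlopeBound (f : ℝ → ℝ) (K x y z : ℝ) : Prop :=
  slope f x y ≤ K * slope f x z ∧ slope f y z ≤ K * slope f x z

lemma StepBound.mono {f : ℝ → ℝ} {d C C' a b c e : ℝ} (h : StepBound f d C a b c e) (hC : C ≤ C') :
    StepBound f d C' a b c e :=
  ⟨fun hx => (h.noncrit hx).trans (Real.exp_le_exp.2 (by gcongr)), h.mid, h.side⟩

lemma SlopeBound.mono {f : ℝ → ℝ} (hf : StrictMono f) {K K' x y z : ℝ} (h : SlopeBound f K x y z)
    (hxz : x < z) (hK : K ≤ K') : SlopeBound f K' x y z := by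
  have := mul_le_mul_of_nonneg_right hK (slope_pos_of_lt hxz (hf hxz)).le
  exact ⟨h.1.trans this, h.2.trans this⟩

/-- Uniform one-step bounds on a ball. -/
def LocalBounds (f : ℝ → ℝ) (d x₀ : ℝ) : Prop :=
  ∃ r > 0, ∃ C ≥ 0, ∃ K ≥ 1,
    (∀ a b c e, a ∈ Metric.ball x₀ r → e ∈ Metric.ball x₀ r → a < b → b < c → c < e →
      StepBound f d C a b c e) ∧
    ∀ x y z, x ∈ Metric.ball x₀ r → z ∈ Metric.ball x₀ r → x < y → y < z → SlopeBound f K x y z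

lemma localBounds_of_deriv_pos {f : ℝ → ℝ} {x₀ : ℝ} (d : ℝ) (hf : ContDiff ℝ 3 f)
    (h0 : 0 < deriv f x₀) : LocalBounds f d x₀ := by
  obtain ⟨r, hr, C, hC, h1, h2⟩ :=
    exists_crD_le_exp hf.contDiffAt h0 (η := 1 / 2) (by norm_num) (by norm_num)
  have hev : ∀ᶠ x in 𝓝 x₀, 0 < deriv f x :=
    (hf.continuous_deriv (by norm_num)).continuousAt.eventually (lt_mem_nhds h0)
  obtain ⟨r₁, hr₁, hb⟩ := Metric.eventually_nhds_iff_ball.1 hev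
  have s1 : Metric.ball x₀ (min r r₁) ⊆ Metric.ball x₀ r :=
    Metric.ball_subset_ball (min_le_left _ _)
  have s2 : Metric.ball x₀ (min r r₁) ⊆ Metric.ball x₀ r₁ :=
    Metric.ball_subset_ball (min_le_right _ _)
  refine ⟨min r r₁, lt_min hr hr₁, C, hC, 3, by norm_num, ?_, ?_⟩
  · intro a b c e ha he hab hbc hce
    have hne : ∀ x ∈ Icc a e, deriv f x ≠ 0 := fun x hx =>
      (hb x (s2 ((convex_ball x₀ _).ordConnected.out ha he hx))).ne'
    refine ⟨fun _ => h2 a b c e (s1 ha) (s1 he) hab hbc hce, ?_, ?_⟩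
    · exact fun x hx h => absurd h (hne x ⟨by linarith [hx.1], by linarith [hx.2]⟩)
    · rintro x (hx | hx) h
      · exact absurd h (hne x ⟨by linarith [hx.1], by linarith [hx.2]⟩)
      · exact absurd h (hne x ⟨by linarith [hx.1], by linarith [hx.2]⟩)
  · intro x y z hx hz hxy hyz
    have hy : y ∈ Metric.ball x₀ r :=
      (convex_ball x₀ _).ordConnected.out (s1 hx) (s1 hz) ⟨hxy.le, hyz.le⟩
    have a1 := h1 x (s1 hx) y hy hxy
    have a2 := h1 y hy z (s1 hz) hyz
    have a3 := h1 x (s1 hx) z (s1 hz) (hxy.trans hyz)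
    constructor <;> linarith [a1.2, a2.2, a3.1]

/-- Near a critical point `f` is a power map in a `C³` coordinate. -/
lemma exists_power_coordinate {f : ℝ → ℝ} {c d : ℝ} (hf : StrictMono f)
    (h : IsNonFlatCritPt f c d) :
    1 < d ∧ ∃ φ : ℝ → ℝ, ContDiffAt ℝ 3 φ c ∧ φ c = 0 ∧ 0 < deriv φ c ∧
      ∀ᶠ x in 𝓝 c, f x = f c + signedPow d (φ x) := by
  obtain ⟨hd, W, φ, hW, hcW, hφ, hφc, hne, -, hfφ⟩ := h
  have hWn := hW.mem_nhds hcW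
  have hφ3 := hφ.contDiffAt hWn
  have hev : ∀ᶠ x in 𝓝 c, f x = f c + signedPow d (φ x) := by
    filter_upwards [hWn] with x hx using hfφ x hx
  refine ⟨hd, φ, hφ3, hφc, ?_, hev⟩
  have hder : HasDerivAt φ (deriv φ c) c := (hφ3.differentiableAt (by norm_num)).hasDerivAt
  have ht : Tendsto (slope φ c) (𝓝[>] c) (𝓝 (deriv φ c)) :=
    hder.tendsto_slope.mono_left (nhdsWithin_mono _ (fun x hx => ne_of_gt hx))
  refine lt_of_le_of_ne (ge_of_tendsto ht ?_) (hne c hcW).symm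
  filter_upwards [hev.filter_mono nhdsWithin_le_nhds, self_mem_nhdsWithin] with x hx hcx
  have h1 : 0 < signedPow d (φ x) := by linarith [hf (show c < x from hcx)]
  have h2 : 0 < φ x := by
    by_contra hneg
    have := (signedPow_strictMono hd).monotone (not_lt.1 hneg)
    have h0 : signedPow d 0 = 0 := by simp [signedPow]
    linarith
  rw [slope_def_field, hφc, sub_zero]
  exact (div_pos h2 (sub_pos.2 hcx)).le

lemma localBounds_of_power {f : ℝ → ℝ} {x₀ d' d : ℝ} {φ : ℝ → ℝ}
    (hd' : 1 < d') (hdd : d' ≤ d) (hφ : ContDiffAt ℝ 3 φ x₀) (h0 : φ x₀ = 0)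
    (hpos : 0 < deriv φ x₀) (hev : ∀ᶠ x in 𝓝 x₀, f x = f x₀ + signedPow d' (φ x))
    (hcrit : deriv f x₀ = 0) (hiso : ∀ᶠ x in 𝓝 x₀, deriv f x = 0 → x = x₀) :
    LocalBounds f d x₀ := by
  obtain ⟨r, hr, C, hC, h1, h2⟩ :=
    exists_crD_le_exp hφ hpos (η := 1 / 10) (by norm_num) (by norm_num)
  obtain ⟨r₁, hr₁, hb⟩ := Metric.eventually_nhds_iff_ball.1 (hev.and hiso)
  set D := deriv φ x₀
  set ρ := min r r₁
  have s1 : Metric.ball x₀ ρ ⊆ Metric.ball x₀ r :=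
    Metric.ball_subset_ball (min_le_left _ _)
  have s2 : Metric.ball x₀ ρ ⊆ Metric.ball x₀ r₁ :=
    Metric.ball_subset_ball (min_le_right _ _)
  have hρ : 0 < ρ := lt_min hr hr₁
  have hx₀ : x₀ ∈ Metric.ball x₀ ρ := Metric.mem_ball_self hρ
  have hsl : ∀ x ∈ Metric.ball x₀ ρ, ∀ y ∈ Metric.ball x₀ ρ, x < y →
      9 / 10 * D ≤ slope φ x y ∧ slope φ x y ≤ 11 / 10 * D := fun x hx y hy hxy => by
    have := h1 x (s1 hx) y (s1 hy) hxy
    constructor <;> linarith [this.1, this.2]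
  have hslp : ∀ x ∈ Metric.ball x₀ ρ, ∀ y ∈ Metric.ball x₀ ρ, x < y → 0 < slope φ x y :=
    fun x hx y hy hxy => lt_of_lt_of_le (by linarith) (hsl x hx y hy hxy).1
  have hmono : ∀ x ∈ Metric.ball x₀ ρ, ∀ y ∈ Metric.ball x₀ ρ, x < y → φ x < φ y :=
    fun x hx y hy hxy => by
      have := hslp x hx y hy hxy
      rw [slope_def_field, div_pos_iff_of_pos_right (by linarith)] at this
      linarith
  have hmono' : ∀ x ∈ Metric.ball x₀ ρ, ∀ y ∈ Metric.ball x₀ ρ, x ≤ y → φ x ≤ φ y :=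
    fun x hx y hy hxy => by
      rcases hxy.eq_or_lt with rfl | h
      · exact le_rfl
      · exact (hmono x hx y hy h).le
  have hfe : ∀ x ∈ Metric.ball x₀ ρ, f x = f x₀ + signedPow d' (φ x) :=
    fun x hx => (hb x (s2 hx)).1
  refine ⟨ρ, hρ, C, hC, 2 * d * (11 / 9), by linarith, ?_, ?_⟩
  · intro a b c e ha he hab hbc hce
    have hoc := (convex_ball x₀ ρ).ordConnected.out ha he
    have hbm : b ∈ Metric.ball x₀ ρ := hoc ⟨hab.le, by linarith⟩
    have hcm : c ∈ Metric.ball x₀ ρ := hoc ⟨by linarith, hce.le⟩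
    have pab := hmono a ha b hbm hab
    have pbc := hmono b hbm c hcm hbc
    have pce := hmono c hcm e he hce
    have hcomp : crD f a b c e =
        crD (signedPow d') (φ a) (φ b) (φ c) (φ e) * crD φ a b c e := by
      rw [← crD_comp _ _ (crossRatio_pos pab pbc pce).ne',
        ← crD_add_const (signedPow d' ∘ φ) (f x₀)]
      exact crD_congr (hfe a ha) (hfe b hbm) (hfe c hcm) (hfe e he)
    have hsP := signedPow_strictMono hd'
    have hφ0 : 0 ≤ crD φ a b c e :=
      (div_pos (crossRatio_pos pab pbc pce) (crossRatio_pos hab hbc hce)).le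
    have hP0 := (crD_pos hsP pab pbc pce).le
    have hφK : crD φ a b c e ≤ 3 / 2 := by
      refine (crD_le_mul (K₁ := 11 / 9) (K₂ := 11 / 9) (hslp a ha c hcm (hab.trans hbc))
        (hslp b hbm e he (hbc.trans hce)) (hslp c hcm e he hce).le (by norm_num) ?_ ?_).trans
        (by norm_num)
      · linarith [(hsl a ha b hbm hab).2, (hsl a ha c hcm (hab.trans hbc)).1]
      · linarith [(hsl c hcm e he hce).2, (hsl b hbm e he (hbc.trans hce)).1]
    have huniq : ∀ x ∈ Ioo a e, deriv f x = 0 → x = x₀ := fun x hx =>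
      (hb x (s2 (hoc ⟨hx.1.le, hx.2.le⟩))).2
    refine ⟨fun hne => ?_, fun x hx hx0 => ?_, fun x hx hx0 => ?_⟩
    · have hside : 0 ≤ φ a ∨ φ e ≤ 0 := by
        rcases le_or_gt x₀ a with h | h
        · left; rw [← h0]; exact hmono' x₀ hx₀ a ha h
        · right; rw [← h0]
          refine hmono' e he x₀ hx₀ ?_
          by_contra h'
          exact hne x₀ ⟨h, not_le.1 h'⟩ hcrit
      rw [hcomp]
      have := h2 a b c e (s1 ha) (s1 he) hab hbc hce
      have h3 := crD_signedPow_le_one hd' hside pab pbc pce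
      calc _ ≤ 1 * crD φ a b c e := mul_le_mul_of_nonneg_right h3 hφ0
        _ ≤ _ := by rwa [one_mul]
    · rw [hcomp]
      have h3 := crD_signedPow_le hd' pab pbc pce
      calc _ ≤ 4 * d' ^ 2 * (3 / 2) := mul_le_mul h3 hφK hφ0 (by positivity)
        _ ≤ 4 * d ^ 2 * (3 / 2) := by gcongr
        _ ≤ _ := by nlinarith [sq_nonneg d]
    · rw [hcomp]
      have h3 : crD (signedPow d') (φ a) (φ b) (φ c) (φ e) ≤ 2 * d' := by
        rcases hx with hx | hx
        · have hxx := huniq x ⟨hx.1, by linarith [hx.2]⟩ hx0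
          subst hxx
          refine crD_signedPow_le_of_left hd' ?_ ?_ pab pbc pce
          · rw [← h0]; exact hmono' _ ha _ hx₀ hx.1.le
          · rw [← h0]; exact hmono' _ hx₀ _ hbm hx.2
        · have hxx := huniq x ⟨by linarith [hx.1], hx.2⟩ hx0
          subst hxx
          refine crD_signedPow_le_of_right hd' ?_ ?_ pab pbc pce
          · rw [← h0]; exact hmono' _ hcm _ hx₀ hx.1
          · rw [← h0]; exact hmono' _ hx₀ _ he hx.2.le
      calc _ ≤ 2 * d' * (3 / 2) := mul_le_mul h3 hφK hφ0 (by positivity)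
        _ ≤ 3 * d := by linarith
  · intro x y z hx hz hxy hyz
    have hy : y ∈ Metric.ball x₀ ρ :=
      (convex_ball x₀ _).ordConnected.out hx hz ⟨hxy.le, hyz.le⟩
    have hfs : ∀ u ∈ Metric.ball x₀ ρ, ∀ v ∈ Metric.ball x₀ ρ, u < v →
        slope f u v = slope (signedPow d') (φ u) (φ v) * slope φ u v := by
      intro u hu v hv huv
      have := hmono u hu v hv huv
      rw [slope_def_field, slope_def_field, slope_def_field, hfe u hu, hfe v hv,
        div_mul_div_cancel₀ (by linarith)]
      ring
    have pxy := hmono x hx y hy hxy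
    have pyz := hmono y hy z hz hyz
    have b3 := hsl x hx z hz (hxy.trans hyz)
    have b1 := hsl x hx y hy hxy
    have b2 := hsl y hy z hz hyz
    have c3 := slope_signedPow_pos hd' (pxy.trans pyz)
    have k1 : slope φ x y ≤ 11 / 9 * slope φ x z := by linarith [b1.2, b3.1]
    have k2 : slope φ y z ≤ 11 / 9 * slope φ x z := by linarith [b2.2, b3.1]
    have l1 := slope_signedPow_le hd' le_rfl pxy pyz.le
    have l2 := slope_signedPow_le hd' pxy.le pyz le_rfl
    have m : 2 * d' * slope (signedPow d') (φ x) (φ z) ≤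
        2 * d * slope (signedPow d') (φ x) (φ z) := by gcongr
    have n0 : 0 ≤ 2 * d * slope (signedPow d') (φ x) (φ z) := by
      have : 0 < d := by linarith
      positivity
    constructor
    · rw [hfs x hx y hy hxy, hfs x hx z hz (hxy.trans hyz)]
      refine (mul_le_mul (l1.trans m) k1 (hslp x hx y hy hxy).le n0).trans (le_of_eq (by ring))
    · rw [hfs y hy z hz hyz, hfs x hx z hz (hxy.trans hyz)]
      refine (mul_le_mul (l2.trans m) k2 (hslp y hy z hz hyz).le n0).trans (le_of_eq (by ring))

/-! ### Uniform one-step bounds -/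

lemma IsCircleMapLift.map_add_int {f : ℝ → ℝ} (hf : IsCircleMapLift f) (x : ℝ) (m : ℤ) :
    f (x + m) = f x + m := by
  induction m using Int.induction_on with
  | zero => simp
  | succ n ih => push_cast at ih ⊢; rw [← add_assoc, hf.periodic, ih]; ring
  | pred n ih =>
    push_cast at ih ⊢
    have := hf.periodic (x + (-n - 1))
    rw [show x + (-n - 1) + 1 = x + -(n : ℝ) by ring, ih] at this
    linarith

lemma IsCircleMapLift.iterate_add_int {f : ℝ → ℝ} (hf : IsCircleMapLift f) (j : ℕ) (x : ℝ)
    (m : ℤ) : f^[j] (x + m) = f^[j] x + m := by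
  induction j with
  | zero => rfl
  | succ j ih => rw [Function.iterate_succ_apply', Function.iterate_succ_apply', ih,
      hf.map_add_int]

lemma IsMulticriticalLift.deriv_add_int {f : ℝ → ℝ} {C : Finset ℝ} {dc : ℝ → ℝ}
    (hf : IsMulticriticalLift f C dc) (x : ℝ) (m : ℤ) :
    deriv f (x + m) = 0 ↔ deriv f x = 0 := by
  rw [hf.2.2.2.1, hf.2.2.2.1]
  constructor
  · rintro ⟨c, hc, k, hk⟩
    exact ⟨c, hc, k - m, by push_cast; linarith⟩
  · rintro ⟨c, hc, k, hk⟩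
    exact ⟨c, hc, k + m, by push_cast; linarith⟩

lemma eventually_eq_of_add_int (c x₀ : ℝ) :
    ∀ᶠ x in 𝓝 x₀, ∀ k : ℤ, x = c + k → x = x₀ := by
  by_cases h : ∃ k₀ : ℤ, x₀ = c + k₀
  · obtain ⟨k₀, hk₀⟩ := h
    filter_upwards [Metric.ball_mem_nhds x₀ one_pos] with x hx k hk
    rw [Metric.mem_ball, Real.dist_eq, hk, hk₀, add_sub_add_left_eq_sub, ← Int.cast_sub,
      ← Int.cast_abs] at hx
    have h1 : |k - k₀| < 1 := by exact_mod_cast hx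
    have : k = k₀ := by rw [Int.abs_lt_one_iff] at h1; omega
    rw [hk, hk₀, this]
  · have hcl : IsClosed ((fun x : ℝ => x - c) ⁻¹' range ((↑) : ℤ → ℝ)) :=
      Int.isClosedEmbedding_coe_real.isClosed_range.preimage (by fun_prop)
    have hx₀ : x₀ ∈ ((fun x : ℝ => x - c) ⁻¹' range ((↑) : ℤ → ℝ))ᶜ := by
      rintro ⟨k, hk⟩
      exact h ⟨k, by simp only at hk; linarith⟩
    filter_upwards [hcl.isOpen_compl.mem_nhds hx₀] with x hx k hk
    exact absurd ⟨k, by simp only; linarith⟩ hx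

lemma IsMulticriticalLift.eventually_crit_eq {f : ℝ → ℝ} {C : Finset ℝ} {dc : ℝ → ℝ}
    (hf : IsMulticriticalLift f C dc) (x₀ : ℝ) :
    ∀ᶠ x in 𝓝 x₀, deriv f x = 0 → x = x₀ := by
  have := (Filter.eventually_all_finset C).2 fun c _ => eventually_eq_of_add_int c x₀
  filter_upwards [this] with x hx h0
  obtain ⟨c, hc, k, hk⟩ := (hf.2.2.2.1 x).1 h0
  exact hx c hc k hk

lemma IsMulticriticalLift.localBounds {f : ℝ → ℝ} {C : Finset ℝ} {dc : ℝ → ℝ} {d : ℝ}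
    (hf : IsMulticriticalLift f C dc) (hd : ∀ c ∈ C, dc c ≤ d) (x₀ : ℝ) : LocalBounds f d x₀ := by
  by_cases h : deriv f x₀ = 0
  · obtain ⟨c, hc, k, hk⟩ := (hf.2.2.2.1 x₀).1 h
    obtain ⟨h1, φ, h2, h3, h4, h5⟩ := exists_power_coordinate hf.1.mono (hf.2.2.2.2 c hc)
    have hx : x₀ - k = c := by linarith
    have ht : Tendsto (fun x : ℝ => x - k) (𝓝 x₀) (𝓝 c) := by
      rw [← hx]; exact (continuous_sub_right _).continuousAt
    refine localBounds_of_power (φ := fun x => φ (x - k)) h1 (hd c hc) ?_ (by simp only [hx, h3])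
      ?_ ?_ h (hf.eventually_crit_eq x₀)
    · rw [← hx] at h2
      exact h2.comp x₀ (contDiffAt_id.sub contDiffAt_const)
    · rw [deriv_comp_sub_const, hx]; exact h4
    · filter_upwards [ht.eventually h5] with x hx'
      have e1 := hf.1.map_add_int (x - k) k
      have e2 := hf.1.map_add_int c k
      rw [sub_add_cancel] at e1
      rw [e1, hk, e2, hx']
      ring
  · refine localBounds_of_deriv_pos d hf.1.smooth (lt_of_le_of_ne ?_ (Ne.symm h))
    exact hf.1.mono.monotone.deriv_nonneg

lemma IsMulticriticalLift.exists_stepBound {f : ℝ → ℝ} {C : Finset ℝ} {dc : ℝ → ℝ} {d : ℝ}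
    (hf : IsMulticriticalLift f C dc) (hd : ∀ c ∈ C, dc c ≤ d) :
    ∃ ε > 0, ∃ B ≥ 0, ∃ K ≥ 1,
      (∀ a b c e, a < b → b < c → c < e → e - a < ε → StepBound f d B a b c e) ∧
      ∀ x y z, x < y → y < z → z - x < ε → SlopeBound f K x y z := by
  have key : ∃ ε > 0, ∃ B ≥ 0, ∃ K ≥ 1,
      (∀ a ∈ Icc (0 : ℝ) 1, ∀ b c e, a < b → b < c → c < e → e - a < ε →
        StepBound f d B a b c e) ∧
      ∀ x ∈ Icc (0 : ℝ) 1, ∀ y z, x < y → y < z → z - x < ε → SlopeBound f K x y z := by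
    refine isCompact_Icc.induction_on (p := fun s => ∃ ε > 0, ∃ B ≥ 0, ∃ K ≥ 1,
      (∀ a ∈ s, ∀ b c e, a < b → b < c → c < e → e - a < ε →
        StepBound f d B a b c e) ∧
      ∀ x ∈ s, ∀ y z, x < y → y < z → z - x < ε → SlopeBound f K x y z)
      ⟨1, one_pos, 0, le_rfl, 1, le_rfl, by simp, by simp⟩ ?_ ?_ ?_
    · rintro s t hst ⟨ε, hε, B, hB, K, hK, h1, h2⟩
      exact ⟨ε, hε, B, hB, K, hK, fun a ha => h1 a (hst ha), fun x hx => h2 x (hst hx)⟩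
    · rintro s t ⟨ε, hε, B, hB, K, hK, h1, h2⟩ ⟨ε', hε', B', hB', K', hK', h1', h2'⟩
      refine ⟨min ε ε', lt_min hε hε', max B B', le_max_of_le_left hB, max K K',
        le_max_of_le_left hK, ?_, ?_⟩
      · rintro a (ha | ha) b c e hab hbc hce hae
        · exact (h1 a ha b c e hab hbc hce (hae.trans_le (min_le_left _ _))).mono (le_max_left _ _)
        · exact (h1' a ha b c e hab hbc hce (hae.trans_le (min_le_right _ _))).mono
            (le_max_right _ _)
      · rintro x (hx | hx) y z hxy hyz hxz
        · exact (h2 x hx y z hxy hyz (hxz.trans_le (min_le_left _ _))).mono hf.1.mono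
            (hxy.trans hyz) (le_max_left _ _)
        · exact (h2' x hx y z hxy hyz (hxz.trans_le (min_le_right _ _))).mono hf.1.mono
            (hxy.trans hyz) (le_max_right _ _)
    · intro x₀ _
      obtain ⟨r, hr, B, hB, K, hK, h1, h2⟩ := hf.localBounds hd x₀
      refine ⟨Metric.ball x₀ (r / 2), mem_nhdsWithin_of_mem_nhds
        (Metric.ball_mem_nhds _ (by positivity)), r / 2, by positivity, B, hB, K, hK, ?_, ?_⟩
      · intro a ha b c e hab hbc hce hae
        rw [Metric.mem_ball, Real.dist_eq, abs_lt] at ha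
        refine h1 a b c e ?_ ?_ hab hbc hce <;> rw [Metric.mem_ball, Real.dist_eq, abs_lt] <;>
          constructor <;> linarith [ha.1, ha.2]
      · intro x hx y z hxy hyz hxz
        rw [Metric.mem_ball, Real.dist_eq, abs_lt] at hx
        refine h2 x y z ?_ ?_ hxy hyz <;> rw [Metric.mem_ball, Real.dist_eq, abs_lt] <;>
          constructor <;> linarith [hx.1, hx.2]
  obtain ⟨ε, hε, B, hB, K, hK, h1, h2⟩ := key
  have hfl : ∀ a : ℝ, a + ((-⌊a⌋ : ℤ) : ℝ) ∈ Icc (0 : ℝ) 1 := fun a => by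
    push_cast
    exact ⟨by linarith [Int.floor_le a], by linarith [Int.lt_floor_add_one a]⟩
  refine ⟨ε, hε, B, hB, K, hK, ?_, ?_⟩
  · intro a b c e hab hbc hce hae
    set m : ℤ := -⌊a⌋
    have h := h1 (a + m) (hfl a) (b + m) (c + m) (e + m) (by linarith) (by linarith) (by linarith)
      (by linarith)
    have hs := crD_shift (m := (m : ℝ)) (fun x => hf.1.map_add_int x m) a b c e
    refine ⟨fun hne => ?_, fun x hx hx0 => ?_, fun x hx hx0 => ?_⟩
    · rw [← hs]
      refine (h.noncrit fun x hx => ?_).trans (le_of_eq (by ring_nf))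
      have h3 := hne (x - m) ⟨by linarith [hx.1], by linarith [hx.2]⟩
      rwa [Ne, ← hf.deriv_add_int _ m, sub_add_cancel] at h3
    · rw [← hs]
      exact h.mid (x + m) ⟨by linarith [hx.1], by linarith [hx.2]⟩ ((hf.deriv_add_int x m).2 hx0)
    · rw [← hs]
      refine h.side (x + m) ?_ ((hf.deriv_add_int x m).2 hx0)
      rcases hx with hx | hx
      · exact Or.inl ⟨by linarith [hx.1], by linarith [hx.2]⟩
      · exact Or.inr ⟨by linarith [hx.1], by linarith [hx.2]⟩
  · intro x y z hxy hyz hxz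
    set m : ℤ := -⌊x⌋
    have h := h2 (x + m) (hfl x) (y + m) (z + m) (by linarith) (by linarith) (by linarith)
    have hs : ∀ u v, slope f (u + m) (v + m) = slope f u v := fun u v => by
      rw [slope_def_field, slope_def_field, hf.1.map_add_int, hf.1.map_add_int,
        add_sub_add_right_eq_sub, add_sub_add_right_eq_sub]
    rwa [SlopeBound, hs, hs, hs] at h

/-- Rough bound for the one-step cross-ratio distortion at all scales. -/
lemma IsMulticriticalLift.exists_crD_le {f : ℝ → ℝ} {C : Finset ℝ} {dc : ℝ → ℝ}
    (hf : IsMulticriticalLift f C dc) :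
    ∃ B ≥ 0, ∃ K ≥ 1, ∀ a b c e, a < b → b < c → c < e → e - a ≤ 3 →
      crD f a b c e ≤ K ∧
      ((∀ x ∈ Ioo a e, deriv f x ≠ 0) → crD f a b c e ≤ Real.exp (B * (e - a))) := by
  obtain ⟨D, hD⟩ := (C.finite_toSet.image dc).bddAbove
  obtain ⟨ε, hε, B, hB, K, hK, h1, h2⟩ :=
    hf.exists_stepBound (d := D) fun c hc => hD ⟨c, hc, rfl⟩
  have hmono := hf.1.mono
  set K' := K * (1 + 6 / ε) with hK'
  have hKK : K ≤ K' := le_mul_of_one_le_right (by linarith) (by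
    have : 0 < 6 / ε := by positivity
    linarith)
  have hKε : 6 / ε ≤ K' := by
    have : 0 < 6 / ε := by positivity
    rw [hK']; nlinarith
  have hcoarse : ∀ u v x z, x ≤ u → v ≤ z → ε / 2 ≤ v - u → z - x ≤ 3 →
      slope f u v ≤ 6 / ε * slope f x z := by
    intro u v x z hxu hvz huv hxz
    have hz : 0 < z - x := by linarith
    rw [slope_def_field, slope_def_field, div_le_iff₀ (by linarith)]
    have e1 : f v - f u ≤ f z - f x := by
      linarith [hmono.monotone hxu, hmono.monotone hvz]
    have e2 : 0 ≤ f z - f x := by linarith [hmono (sub_pos.1 hz)]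
    have e3 : 1 ≤ 6 / ε * (v - u) / (z - x) := by
      rw [le_div_iff₀ hz, one_mul]
      calc z - x ≤ 6 / ε * (ε / 2) := by field_simp; linarith
        _ ≤ _ := by gcongr
    calc f v - f u ≤ (f z - f x) * 1 := by linarith
      _ ≤ (f z - f x) * (6 / ε * (v - u) / (z - x)) := by gcongr
      _ = _ := by ring
  have hslope : ∀ x y z, x < y → y < z → z - x ≤ 3 → SlopeBound f K' x y z := by
    intro x y z hxy hyz hxz
    have hp := (slope_pos_of_lt (hxy.trans hyz) (hmono (hxy.trans hyz))).le
    have hle : ∀ s, s ≤ K * (6 / ε * slope f x z) → s ≤ K' * slope f x z := fun s hs => by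
      rw [hK']
      have : 0 ≤ K * slope f x z := by positivity
      linarith
    rcases lt_or_ge (z - x) ε with h | h
    · exact (h2 x y z hxy hyz h).mono hmono (hxy.trans hyz) hKK
    · constructor
      · rcases lt_or_ge (y - x) (ε / 2) with h' | h'
        · have a1 := (h2 x y (x + ε / 2) hxy (by linarith) (by linarith)).1
          have a2 := hcoarse x (x + ε / 2) x z le_rfl (by linarith) (by linarith) hxz
          exact hle _ (a1.trans (mul_le_mul_of_nonneg_left a2 (by linarith)))
        · exact (hcoarse x y x z le_rfl hyz.le h' hxz).trans
            (mul_le_mul_of_nonneg_right hKε hp)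
      · rcases lt_or_ge (z - y) (ε / 2) with h' | h'
        · have a1 := (h2 (z - ε / 2) y z (by linarith) hyz (by linarith)).2
          have a2 := hcoarse (z - ε / 2) z x z (by linarith) le_rfl (by linarith) hxz
          exact hle _ (a1.trans (mul_le_mul_of_nonneg_left a2 (by linarith)))
        · exact (hcoarse y z x z hxy.le le_rfl h' hxz).trans
            (mul_le_mul_of_nonneg_right hKε hp)
  have hK'1 : 1 ≤ K' := hK.le.trans hKK
  have hcr : ∀ a b c e, a < b → b < c → c < e → e - a ≤ 3 → crD f a b c e ≤ K' * K' := by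
    intro a b c e hab hbc hce hae
    exact crD_le_mul (slope_pos_of_lt (hab.trans hbc) (hmono (hab.trans hbc)))
      (slope_pos_of_lt (hbc.trans hce) (hmono (hbc.trans hce)))
      (slope_pos_of_lt hce (hmono hce)).le (by linarith)
      (hslope a b c hab hbc (by linarith)).1 (hslope b c e hbc hce (by linarith)).2
  have hL : 0 ≤ Real.log (K' * K') := Real.log_nonneg (by nlinarith)
  refine ⟨3 * B + Real.log (K' * K') / ε, by positivity, K' * K', by nlinarith, ?_⟩
  intro a b c e hab hbc hce hae
  refine ⟨hcr a b c e hab hbc hce hae, fun hne => ?_⟩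
  have hpos : 0 < e - a := by linarith
  rcases lt_or_ge (e - a) ε with h | h
  · refine ((h1 a b c e hab hbc hce h).noncrit hne).trans (Real.exp_le_exp.2 ?_)
    have : 0 ≤ Real.log (K' * K') / ε * (e - a) := by positivity
    have : B * (e - a) * (e - a) ≤ B * (e - a) * 3 := by gcongr
    nlinarith
  · refine (hcr a b c e hab hbc hce hae).trans ?_
    rw [← Real.log_le_iff_le_exp (by nlinarith)]
    have : Real.log (K' * K') / ε * ε ≤ Real.log (K' * K') / ε * (e - a) := by gcongr
    rw [div_mul_cancel₀ _ hε.ne'] at this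
    have : 0 ≤ 3 * B * (e - a) := by positivity
    linarith

/-! ### Continued fraction estimates -/

/-- The signed error `qₙ ρ - pₙ` of the `n`-th convergent. -/
def convErr (ρ : ℝ) (n : ℕ) : ℝ := qden ρ n * ρ - pnum ρ n

/-- The error `|qₙ ρ - pₙ|` of the `n`-th convergent. -/
def convGap (ρ : ℝ) (n : ℕ) : ℝ := |convErr ρ n|

section Arithmetic

variable {ρ : ℝ}

lemma gaussMap_iterate_mem (hirr : Irrational ρ) (hρ : ρ ∈ Ioo (0 : ℝ) 1) (n : ℕ) :
    Irrational (gaussMap^[n] (Int.fract ρ)) ∧ gaussMap^[n] (Int.fract ρ) ∈ Ioo (0 : ℝ) 1 := by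
  induction n with
  | zero =>
    rw [Int.fract_eq_self.2 ⟨hρ.1.le, hρ.2⟩]
    exact ⟨hirr, hρ⟩
  | succ n ih =>
    rw [Function.iterate_succ_apply']
    have h1 : Irrational (gaussMap (gaussMap^[n] (Int.fract ρ))) :=
      (ih.1.inv).sub_intCast _
    refine ⟨h1, lt_of_le_of_ne (Int.fract_nonneg _) ?_, Int.fract_lt_one _⟩
    exact h1.ne_zero.symm

lemma one_le_cfA (hirr : Irrational ρ) (hρ : ρ ∈ Ioo (0 : ℝ) 1) (n : ℕ) : 1 ≤ cfA ρ n := by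
  have h := (gaussMap_iterate_mem hirr hρ n).2
  rw [cfA, Nat.one_le_floor_iff]
  exact (one_le_inv₀ h.1).2 h.2.le

lemma gaussMap_iterate_succ (hirr : Irrational ρ) (hρ : ρ ∈ Ioo (0 : ℝ) 1) (n : ℕ) :
    gaussMap^[n + 1] (Int.fract ρ) = (gaussMap^[n] (Int.fract ρ))⁻¹ - cfA ρ n := by
  have h := (gaussMap_iterate_mem hirr hρ n).2
  rw [Function.iterate_succ_apply', gaussMap, Int.fract, cfA,
    natCast_floor_eq_intCast_floor (inv_nonneg.2 h.1.le)]

lemma convErr_add_two (n : ℕ) :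
    convErr ρ (n + 2) = cfA ρ (n + 1) * convErr ρ (n + 1) + convErr ρ n := by
  simp only [convErr, qden, pnum]
  push_cast
  ring

lemma convErr_succ (hirr : Irrational ρ) (hρ : ρ ∈ Ioo (0 : ℝ) 1) (n : ℕ) :
    convErr ρ (n + 1) = -(gaussMap^[n + 1] (Int.fract ρ)) * convErr ρ n := by
  induction n with
  | zero =>
    rw [gaussMap_iterate_succ hirr hρ]
    have : ρ ≠ 0 := hρ.1.ne'
    simp only [convErr, qden, pnum, Function.iterate_zero, id, Int.fract_eq_self.2 ⟨hρ.1.le, hρ.2⟩]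
    push_cast
    field_simp
    ring
  | succ n ih =>
    have h := (gaussMap_iterate_mem hirr hρ (n + 1)).2.1.ne'
    have e : convErr ρ n = -(gaussMap^[n + 1] (Int.fract ρ))⁻¹ * convErr ρ (n + 1) := by
      rw [ih]; field_simp
    rw [convErr_add_two, gaussMap_iterate_succ hirr hρ (n + 1), e]
    ring

lemma convErr_ne_zero (hirr : Irrational ρ) (hρ : ρ ∈ Ioo (0 : ℝ) 1) (n : ℕ) :
    convErr ρ n ≠ 0 := by
  induction n with
  | zero => simpa [convErr, qden, pnum] using hρ.1.ne'
  | succ n ih =>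
    rw [convErr_succ hirr hρ]
    exact mul_ne_zero (neg_ne_zero.2 (gaussMap_iterate_mem hirr hρ (n + 1)).2.1.ne') ih

lemma convGap_pos (hirr : Irrational ρ) (hρ : ρ ∈ Ioo (0 : ℝ) 1) (n : ℕ) : 0 < convGap ρ n :=
  abs_pos.2 (convErr_ne_zero hirr hρ n)

/-- Consecutive errors have opposite signs. -/
lemma convErr_sign (hirr : Irrational ρ) (hρ : ρ ∈ Ioo (0 : ℝ) 1) (n : ℕ) :
    (convErr ρ n = convGap ρ n ∧ convErr ρ (n + 1) = -convGap ρ (n + 1)) ∨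
      (convErr ρ n = -convGap ρ n ∧ convErr ρ (n + 1) = convGap ρ (n + 1)) := by
  have hx := (gaussMap_iterate_mem hirr hρ (n + 1)).2.1
  have hs := convErr_succ hirr hρ n
  unfold convGap
  rcases lt_or_gt_of_ne (convErr_ne_zero hirr hρ n) with h | h
  · have : 0 < convErr ρ (n + 1) := by rw [hs]; nlinarith
    right
    rw [abs_of_neg h, abs_of_pos this]
    simp
  · have : convErr ρ (n + 1) < 0 := by rw [hs]; nlinarith
    left
    rw [abs_of_pos h, abs_of_neg this]
    simp

lemma convGap_eq (hirr : Irrational ρ) (hρ : ρ ∈ Ioo (0 : ℝ) 1) (n : ℕ) :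
    convGap ρ n = cfA ρ (n + 1) * convGap ρ (n + 1) + convGap ρ (n + 2) := by
  have h2 := convErr_add_two (ρ := ρ) n
  rcases convErr_sign hirr hρ n with h | h <;> rcases convErr_sign hirr hρ (n + 1) with h' | h' <;>
    have p1 := convGap_pos hirr hρ (n + 1)
  · linarith [h.2, h'.1]
  · rw [h.1, h.2, h'.2] at h2; linarith
  · rw [h.1, h.2, h'.2] at h2; linarith
  · linarith [h.2, h'.1]

lemma convGap_add_le (hirr : Irrational ρ) (hρ : ρ ∈ Ioo (0 : ℝ) 1) (n : ℕ) :
    convGap ρ (n + 1) + convGap ρ (n + 2) ≤ convGap ρ n := by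
  rw [convGap_eq hirr hρ n]
  have : (1 : ℝ) ≤ cfA ρ (n + 1) := by exact_mod_cast one_le_cfA hirr hρ (n + 1)
  nlinarith [convGap_pos hirr hρ (n + 1)]

lemma convGap_succ_lt (hirr : Irrational ρ) (hρ : ρ ∈ Ioo (0 : ℝ) 1) (n : ℕ) :
    convGap ρ (n + 1) < convGap ρ n := by
  linarith [convGap_add_le hirr hρ n, convGap_pos hirr hρ (n + 2)]

lemma convGap_antitone (hirr : Irrational ρ) (hρ : ρ ∈ Ioo (0 : ℝ) 1) : Antitone (convGap ρ) :=
  antitone_nat_of_succ_le fun n => (convGap_succ_lt hirr hρ n).le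

lemma convGap_lt_one (hirr : Irrational ρ) (hρ : ρ ∈ Ioo (0 : ℝ) 1) (n : ℕ) :
    convGap ρ n < 1 := by
  refine (convGap_antitone hirr hρ (Nat.zero_le n)).trans_lt ?_
  simp only [convGap, convErr, qden, pnum]
  rw [abs_of_nonneg] <;> push_cast <;> linarith [hρ.1, hρ.2]

lemma tendsto_convGap (hirr : Irrational ρ) (hρ : ρ ∈ Ioo (0 : ℝ) 1) :
    Tendsto (convGap ρ) atTop (𝓝 0) := by
  have hdec : ∀ k : ℕ, convGap ρ (2 * k) ≤ (1 / 2) ^ k := by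
    intro k
    induction k with
    | zero => simpa using (convGap_lt_one hirr hρ 0).le
    | succ k ih =>
      have h1 := convGap_add_le hirr hρ (2 * k)
      have h2 := convGap_succ_lt hirr hρ (2 * k + 1)
      rw [show 2 * (k + 1) = 2 * k + 1 + 1 by ring, pow_succ]
      linarith
  rw [Metric.tendsto_atTop]
  intro ε hε
  obtain ⟨k, hk⟩ := exists_pow_lt_of_lt_one hε (by norm_num : (1 / 2 : ℝ) < 1)
  refine ⟨2 * k, fun n hn => ?_⟩
  rw [Real.dist_eq, sub_zero, abs_of_pos (convGap_pos hirr hρ n)]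
  exact ((convGap_antitone hirr hρ hn).trans (hdec k)).trans_lt hk

lemma qden_pos (hirr : Irrational ρ) (hρ : ρ ∈ Ioo (0 : ℝ) 1) (n : ℕ) :
    0 < qden ρ n ∧ 0 < qden ρ (n + 1) := by
  induction n with
  | zero => exact ⟨by simp [qden], one_le_cfA hirr hρ 0⟩
  | succ n ih =>
    refine ⟨ih.2, ?_⟩
    rw [qden]
    exact Nat.add_pos_right _ ih.1

lemma qden_le_succ (hirr : Irrational ρ) (hρ : ρ ∈ Ioo (0 : ℝ) 1) (n : ℕ) :
    qden ρ n ≤ qden ρ (n + 1) := by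
  cases n with
  | zero => simpa [qden] using one_le_cfA hirr hρ 0
  | succ n =>
    rw [qden]
    have := Nat.mul_le_mul_right (qden ρ (n + 1)) (one_le_cfA hirr hρ (n + 1))
    omega

lemma qden_pnum_det (n : ℕ) :
    (qden ρ (n + 1) : ℤ) * pnum ρ n - qden ρ n * pnum ρ (n + 1) = (-1) ^ (n + 1) := by
  induction n with
  | zero => simp [qden, pnum]
  | succ n ih =>
    rw [qden, pnum, pow_succ, ← ih]
    push_cast
    ring

/-- Best approximation property of the convergents. -/
lemma convGap_le_abs (hirr : Irrational ρ) (hρ : ρ ∈ Ioo (0 : ℝ) 1) (n : ℕ) {j : ℤ} (hj0 : j ≠ 0)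
    (hj : |j| < qden ρ (n + 1)) (p : ℤ) : convGap ρ n ≤ |j * ρ - p| := by
  set s : ℤ := (-1) ^ (n + 1) with hs
  have hdet := qden_pnum_det (ρ := ρ) n
  rw [← hs] at hdet
  have hs1 : s * s = 1 := by rw [hs, ← mul_pow]; norm_num
  set q : ℤ := ((qden ρ n : ℕ) : ℤ) with hq
  set Q : ℤ := ((qden ρ (n + 1) : ℕ) : ℤ) with hQ
  set P : ℤ := ((pnum ρ n : ℕ) : ℤ) with hP
  set P' : ℤ := ((pnum ρ (n + 1) : ℕ) : ℤ) with hP'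
  have hq0 : 0 < q := Int.natCast_pos.2 (qden_pos hirr hρ n).1
  have hQ0 : 0 < Q := Int.natCast_pos.2 (qden_pos hirr hρ n).2
  obtain ⟨u, v, hju, hpu⟩ : ∃ u v : ℤ, j = u * q + v * Q ∧ p = u * P + v * P' :=
    ⟨s * (Q * p - P' * j), s * (P * j - q * p), by linear_combination (-j) * hs1 - s * j * hdet,
      by linear_combination (-p) * hs1 - s * p * hdet⟩
  have hval : (j : ℝ) * ρ - p = u * convErr ρ n + v * convErr ρ (n + 1) := by
    rw [hju, hpu]
    simp only [convErr, hq, hQ, hP, hP']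
    push_cast
    ring
  rw [hval]
  have g0 := convGap_pos hirr hρ n
  have g1 := convGap_pos hirr hρ (n + 1)
  have hu0 : u ≠ 0 := by
    rintro rfl
    rw [zero_mul, zero_add] at hju
    have hv : v ≠ 0 := by rintro rfl; simp at hju; exact hj0 hju
    rw [hju, abs_mul, abs_of_pos hQ0] at hj
    nlinarith [Int.one_le_abs hv]
  rw [abs_lt] at hj
  have key : (1 ≤ u ∧ v ≤ 0) ∨ (u ≤ -1 ∧ 0 ≤ v) := by
    rcases lt_or_gt_of_ne hu0 with h | h
    · right
      refine ⟨by omega, ?_⟩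
      by_contra hv
      nlinarith
    · left
      refine ⟨by omega, ?_⟩
      by_contra hv
      nlinarith
  rcases key with ⟨h1, h2⟩ | ⟨h1, h2⟩
  · have h1' : (1 : ℝ) ≤ u := by exact_mod_cast h1
    have h2' : (v : ℝ) ≤ 0 := by exact_mod_cast h2
    rcases convErr_sign hirr hρ n with h | h <;> rw [h.1, h.2]
    · refine le_trans ?_ (le_abs_self _); nlinarith
    · refine le_trans ?_ (neg_le_abs _); nlinarith
  · have h1' : (u : ℝ) ≤ -1 := by exact_mod_cast h1
    have h2' : (0 : ℝ) ≤ v := by exact_mod_cast h2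
    rcases convErr_sign hirr hρ n with h | h <;> rw [h.1, h.2]
    · refine le_trans ?_ (neg_le_abs _); nlinarith
    · refine le_trans ?_ (le_abs_self _); nlinarith

end Arithmetic

/-! ### Semiconjugacy with the rotation -/

/-- `F` semiconjugates the circle map lift `f` to the translation by `ρ`. -/
structure IsRotSemiconj (f F : ℝ → ℝ) (ρ : ℝ) : Prop where
  mono : Monotone F
  surj : Function.Surjective F
  add_one : ∀ x, F (x + 1) = F x + 1
  map : ∀ x, F (f x) = F x + ρ

lemma surjective_of_add_one {g : ℝ → ℝ} (hg : Continuous g) (h1 : ∀ x, g (x + 1) = g x + 1) :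
    Function.Surjective g := by
  have hn : ∀ n : ℕ, g n = g 0 + n := fun n => by
    induction n with
    | zero => simp
    | succ n ih => push_cast; rw [h1, ih]; ring
  have hn' : ∀ n : ℕ, g (-n) = g 0 - n := fun n => by
    induction n with
    | zero => simp
    | succ n ih =>
      have := h1 (-(n + 1))
      rw [show -((n : ℝ) + 1) + 1 = -n by ring, ih] at this
      push_cast
      linarith
  intro y
  obtain ⟨n, hy⟩ := exists_nat_ge |y - g 0|
  rw [abs_le] at hy
  exact mem_range_of_exists_le_of_exists_ge hg ⟨-n, by rw [hn']; linarith [hy.1]⟩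
    ⟨n, by rw [hn]; linarith [hy.2]⟩

lemma IsCircleMapLift.surjective {f : ℝ → ℝ} (hf : IsCircleMapLift f) : Function.Surjective f :=
  surjective_of_add_one hf.smooth.continuous hf.periodic

lemma exists_isRotSemiconj {f : ℝ → ℝ} {ρ : ℝ} (hf : IsCircleMapLift f) (hrot : HasRotNumber f ρ)
    (hirr : Irrational ρ) : ∃ F, IsRotSemiconj f F ρ := by
  let f₁ : CircleDeg1Lift := ⟨⟨f, hf.mono.monotone⟩, hf.periodic⟩
  let f₂ : CircleDeg1Lift := ↑(CircleDeg1Lift.translate (Multiplicative.ofAdd ρ))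
  have h1 : Function.Bijective f₁ := ⟨hf.mono.injective, hf.surjective⟩
  have h2 : Function.Bijective f₂ := CircleDeg1Lift.isUnit_iff_bijective.1 (Units.isUnit _)
  have hτ : f₁.translationNumber = f₂.translationNumber := by
    rw [CircleDeg1Lift.translationNumber_translate]
    refine CircleDeg1Lift.translationNumber_eq_of_tendsto₀ _ ?_
    exact hrot
  obtain ⟨F, hF⟩ := CircleDeg1Lift.semiconj_of_bijective_of_translationNumber_eq h1 h2 hτ
  have hmap : ∀ x, F (f x) = F x + ρ := fun x => (hF x).trans (add_comm _ _)
  have hmono : Monotone F := F.monotone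
  have hdense : DenseRange F := by
    have hd : Dense (AddSubgroup.closure {ρ, 1} : Set ℝ) :=
      dense_addSubgroupClosure_pair_iff.2 (by simpa using hirr)
    have hsub : ∀ s ∈ AddSubgroup.closure {ρ, (1 : ℝ)}, ∀ x,
        (∃ y, F y = F x + s) ∧ ∃ y, F y = F x - s := by
      intro s hs
      induction hs using AddSubgroup.closure_induction with
      | mem s hs =>
        rcases hs with rfl | rfl
        · intro x
          obtain ⟨y, rfl⟩ := hf.surjective x
          exact ⟨⟨_, hmap _⟩, y, by rw [hmap]; ring⟩
        · exact fun x => ⟨⟨x + 1, F.map_add_one x⟩, x - 1, by simpa using F.map_sub_int x 1⟩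
      | zero => exact fun x => ⟨⟨x, by simp⟩, x, by simp⟩
      | add s t _ _ ihs iht =>
        intro x
        obtain ⟨⟨y, hy⟩, y', hy'⟩ := ihs x
        obtain ⟨z, hz⟩ := (iht y).1
        obtain ⟨z', hz'⟩ := (iht y').2
        exact ⟨⟨z, by rw [hz, hy]; ring⟩, z', by rw [hz', hy']; ring⟩
      | neg s _ ih =>
        intro x
        obtain ⟨⟨y, hy⟩, y', hy'⟩ := ih x
        exact ⟨⟨y', by rw [hy']; ring⟩, y, by rw [hy]; ring⟩
    have := (Homeomorph.addLeft (F 0)).surjective.denseRange.dense_image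
      (Homeomorph.addLeft (F 0)).continuous hd
    refine this.mono ?_
    rintro _ ⟨s, hs, rfl⟩
    obtain ⟨y, hy⟩ := (hsub s hs 0).1
    exact ⟨y, hy⟩
  exact ⟨F, hmono, surjective_of_add_one (hmono.continuous_of_denseRange hdense) F.map_add_one,
    F.map_add_one, hmap⟩

/-! ### Counting passages through a point -/

namespace IsRotSemiconj

variable {f F : ℝ → ℝ} {ρ : ℝ}

lemma add_int (hF : IsRotSemiconj f F ρ) (x : ℝ) (m : ℤ) : F (x + m) = F x + m := by
  induction m using Int.induction_on with
  | zero => simp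
  | succ n ih => push_cast at ih ⊢; rw [← add_assoc, hF.add_one, ih]; ring
  | pred n ih =>
    push_cast at ih ⊢
    have := hF.add_one (x + (-n - 1))
    rw [show x + (-n - 1) + 1 = x + -(n : ℝ) by ring, ih] at this
    linarith

lemma iterate (hF : IsRotSemiconj f F ρ) (j : ℕ) (x : ℝ) : F (f^[j] x) = F x + j * ρ := by
  induction j with
  | zero => simp
  | succ j ih => rw [Function.iterate_succ_apply', hF.map, ih]; push_cast; ring

lemma lt_of_lt (hF : IsRotSemiconj f F ρ) {x y : ℝ} (h : F x < F y) : x < y :=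
  hF.mono.reflect_lt h

lemma sub_lt_one (hF : IsRotSemiconj f F ρ) {x y : ℝ} (h : F y - F x < 1) : y - x < 1 := by
  have : y < x + 1 := hF.lt_of_lt (by rw [hF.add_one]; linarith)
  linarith

end IsRotSemiconj

lemma card_le_of_separated_Ico {ι : Type*} {s : Finset ι} {v : ι → ℝ} {δ A : ℝ} {m : ℕ}
    (hδ : 0 < δ) (hsep : ∀ i ∈ s, ∀ j ∈ s, i ≠ j → δ ≤ |v i - v j|)
    (hv : ∀ i ∈ s, v i ∈ Ico A (A + m * δ)) : s.card ≤ m := by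
  have : s.card ≤ (Finset.Ico (0 : ℤ) m).card := by
    refine Finset.card_le_card_of_injOn (fun i => ⌊(v i - A) / δ⌋) ?_ ?_
    · intro i hi
      have h := hv i hi
      simp only [Finset.coe_Ico, mem_Ico]
      refine ⟨Int.floor_nonneg.2 (div_nonneg (by linarith [h.1]) hδ.le), ?_⟩
      rw [Int.floor_lt, div_lt_iff₀ hδ]
      push_cast
      linarith [h.2]
    · intro i hi j hj hij
      by_contra hne
      have h1 := Int.abs_sub_lt_one_of_floor_eq_floor hij
      rw [← sub_div, abs_div, abs_of_pos hδ, div_lt_one hδ] at h1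
      have h2 := hsep i hi j hj hne
      rw [show v i - A - (v j - A) = v i - v j by ring] at h1
      linarith
  simpa using this

/-- The rotation by `ρ` moves points by at least `δ` for all positive times less than `Q`. -/
def RotSeparated (ρ δ : ℝ) (Q : ℕ) : Prop :=
  0 < δ ∧ ∀ j : ℤ, j ≠ 0 → |j| < Q → ∀ p : ℤ, δ ≤ |j * ρ - p|

namespace RotSeparated

variable {ρ δ A : ℝ} {Q k m : ℕ} {P : ℕ → Prop} [DecidablePred P]

lemma le_abs_sub (h : RotSeparated ρ δ Q) (hk : k ≤ Q) {i j : ℕ} (hi : i < k) (hj : j < k)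
    (hij : i ≠ j) (p q : ℤ) : δ ≤ |(i * ρ - p) - (j * ρ - q)| := by
  have := h.2 ((i : ℤ) - j) (by omega) (by rw [abs_lt]; omega) (p - q)
  push_cast at this
  rwa [show ((i : ℝ) - j) * ρ - (p - q) = (i * ρ - p) - (j * ρ - q) by ring] at this

lemma card_le_Ico (h : RotSeparated ρ δ Q) (hk : k ≤ Q)
    (hP : ∀ j < k, P j → ∃ p : ℤ, j * ρ - p ∈ Ico A (A + m * δ)) :
    ((Finset.range k).filter P).card ≤ m := by
  choose! p hp using hP
  refine card_le_of_separated_Ico (v := fun j => j * ρ - p j) (A := A) h.1 ?_ ?_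
  · intro i hi j hj hij
    simp only [Finset.mem_filter, Finset.mem_range] at hi hj
    exact h.le_abs_sub hk hi.1 hj.1 hij _ _
  · intro i hi
    simp only [Finset.mem_filter, Finset.mem_range] at hi
    exact hp i hi.1 hi.2

lemma card_le_Ioc (h : RotSeparated ρ δ Q) (hk : k ≤ Q)
    (hP : ∀ j < k, P j → ∃ p : ℤ, j * ρ - p ∈ Ioc A (A + m * δ)) :
    ((Finset.range k).filter P).card ≤ m := by
  choose! p hp using hP
  refine card_le_of_separated_Ico (v := fun j => -(j * ρ - p j)) (A := -(A + m * δ)) h.1 ?_ ?_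
  · intro i hi j hj hij
    simp only [Finset.mem_filter, Finset.mem_range] at hi hj
    rw [neg_sub_neg, abs_sub_comm]
    exact h.le_abs_sub hk hi.1 hj.1 hij _ _
  · intro i hi
    simp only [Finset.mem_filter, Finset.mem_range] at hi
    have := hp i hi.1 hi.2
    exact ⟨by linarith [this.2], by linarith [this.1]⟩

end RotSeparated

open Classical in
/-- Intervals of length at most one covering every point of the circle at most `m` times have
total length at most `2m`. -/
lemma sum_length_le {ι : Type*} (s : Finset ι) (a e : ι → ℝ) (m : ℕ)
    (hae : ∀ j ∈ s, a j ≤ e j) (h1 : ∀ j ∈ s, e j - a j ≤ 1)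
    (hm : ∀ x : ℝ, (s.filter fun j => ∃ p : ℤ, x + p ∈ Ioo (a j) (e j)).card ≤ m) :
    ∑ j ∈ s, (e j - a j) ≤ 2 * m := by
  have hle : ∑ j ∈ s, MeasureTheory.volume (Ioo (Int.fract (a j)) (e j - ⌊a j⌋)) ≤
      m * ENNReal.ofReal 2 := by
    calc ∑ j ∈ s, MeasureTheory.volume (Ioo (Int.fract (a j)) (e j - ⌊a j⌋))
        = ∑ j ∈ s, ∫⁻ x in Ico (0 : ℝ) 2,
            (Ioo (Int.fract (a j)) (e j - ⌊a j⌋)).indicator 1 x := by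
          refine Finset.sum_congr rfl fun j hj => ?_
          rw [MeasureTheory.lintegral_indicator_one measurableSet_Ioo,
            MeasureTheory.Measure.restrict_apply measurableSet_Ioo, inter_eq_left.2]
          intro x hx
          have h := h1 j hj
          have h2 := Int.fract_lt_one (a j)
          have h3 := Int.fract_nonneg (a j)
          rw [Int.fract] at h2
          exact ⟨h3.trans hx.1.le, by linarith [hx.2]⟩
      _ = ∫⁻ x in Ico (0 : ℝ) 2, ∑ j ∈ s,
            (Ioo (Int.fract (a j)) (e j - ⌊a j⌋)).indicator 1 x := by
          rw [MeasureTheory.lintegral_finsetSum]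
          exact fun j _ => measurable_const.indicator measurableSet_Ioo
      _ ≤ ∫⁻ _ in Ico (0 : ℝ) 2, (m : ℝ≥0∞) := by
          refine MeasureTheory.lintegral_mono fun x => ?_
          simp only [indicator_apply, Pi.one_apply, Finset.sum_boole]
          refine Nat.cast_le.2 (le_trans (Finset.card_le_card ?_) (hm x))
          intro j hj
          simp only [Finset.mem_filter] at hj ⊢
          refine ⟨hj.1, ⌊a j⌋, ?_, ?_⟩
          · have := hj.2.1
            rw [Int.fract] at this
            linarith
          · linarith [hj.2.2]
      _ = m * ENNReal.ofReal 2 := by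
          rw [MeasureTheory.setLIntegral_const, Real.volume_Ico, sub_zero]
  have he : ∑ j ∈ s, MeasureTheory.volume (Ioo (Int.fract (a j)) (e j - ⌊a j⌋)) =
      ENNReal.ofReal (∑ j ∈ s, (e j - a j)) := by
    rw [ENNReal.ofReal_sum_of_nonneg fun j hj => sub_nonneg.2 (hae j hj)]
    refine Finset.sum_congr rfl fun j _ => ?_
    rw [Real.volume_Ioo, Int.fract]
    congr 1
    ring
  rw [he, ← ENNReal.ofReal_natCast, ← ENNReal.ofReal_mul (by positivity),
    ENNReal.ofReal_le_ofReal_iff (by positivity)] at hle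
  linarith

open Classical in
lemma sum_iterate_length_le {f F : ℝ → ℝ} {ρ δ : ℝ} {Q k m : ℕ} (hf : IsCircleMapLift f)
    (hF : IsRotSemiconj f F ρ) (hs : RotSeparated ρ δ Q) (hk : k ≤ Q) {a e : ℝ} (hae : a < e)
    (hF1 : F e - F a < 1) (hFm : F e - F a < m * δ) :
    ∑ j ∈ Finset.range k, (f^[j] e - f^[j] a) ≤ 2 * m := by
  refine sum_length_le _ (fun j => f^[j] a) (fun j => f^[j] e) m ?_ ?_ ?_
  · exact fun j _ => (hf.mono.iterate j hae).le
  · intro j _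
    refine (hF.sub_lt_one ?_).le
    rw [hF.iterate, hF.iterate]
    linarith
  · intro x
    refine hs.card_le_Ico (A := F x - F e) hk ?_
    rintro j - ⟨p, hp⟩
    have h1 := hF.mono hp.1.le
    have h2 := hF.mono hp.2.le
    rw [hF.add_int, hF.iterate] at h1 h2
    exact ⟨p, by linarith, by linarith⟩

lemma prod_ite_le {ι : Type*} (s : Finset ι) (P : ι → Prop) [DecidablePred P] {K : ℝ} {m : ℕ}
    (hK : 1 ≤ K) (hm : (s.filter P).card ≤ m) : ∏ j ∈ s, (if P j then K else 1) ≤ K ^ m := by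
  rw [Finset.prod_ite, Finset.prod_const, Finset.prod_const_one, mul_one]
  exact pow_le_pow_right₀ hK hm

/-! ### Cross-ratio distortion of long compositions -/

section Products

variable {f F : ℝ → ℝ} {C : Finset ℝ} {dc : ℝ → ℝ} {ρ δ : ℝ} {Q k : ℕ}

lemma IsMulticriticalLift.deriv_ne_zero_of_forall (hf : IsMulticriticalLift f C dc) {S : Set ℝ}
    (h : ∀ x ∈ C, ¬ ∃ p : ℤ, x + p ∈ S) : ∀ y ∈ S, deriv f y ≠ 0 := by
  intro y hy h0
  obtain ⟨c, hc, p, rfl⟩ := (hf.2.2.2.1 y).1 h0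
  exact h c hc ⟨p, hy⟩

lemma IsMulticriticalLift.deriv_eq_zero (hf : IsMulticriticalLift f C dc) {x : ℝ} (hx : x ∈ C)
    (p : ℤ) : deriv f (x + p) = 0 :=
  (hf.2.2.2.1 _).2 ⟨x, hx, p, rfl⟩

lemma one_le_prod_of_one_le {ι : Type*} {s : Finset ι} {w : ι → ℝ} (hw : ∀ j ∈ s, 1 ≤ w j) :
    1 ≤ ∏ j ∈ s, w j := by
  simpa using Finset.prod_le_prod (s := s) (f := fun _ => (1 : ℝ)) (fun _ _ => zero_le_one) hw

open Classical in
lemma le_prod_of_le {ι : Type*} {s : Finset ι} {w : ι → ℝ} {y : ℝ} {i : ι} (hw : ∀ j ∈ s, 1 ≤ w j)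
    (hi : i ∈ s) (h : y ≤ w i) : y ≤ ∏ j ∈ s, w j := by
  refine h.trans ?_
  rw [← Finset.mul_prod_erase s w hi]
  exact le_mul_of_one_le_right (by linarith [hw i hi])
    (one_le_prod_of_one_le fun j hj => hw j (Finset.mem_of_mem_erase hj))

open Classical in
/-- Rough bound for the distortion of an iterate on an interval of bounded combinatorial size. -/
lemma IsMulticriticalLift.exists_crD_iterate_le (hf : IsMulticriticalLift f C dc)
    (hF : IsRotSemiconj f F ρ) :
    ∃ K : ℝ, 0 < K ∧ ∀ δ Q k a b c e, RotSeparated ρ δ Q → k ≤ Q → a < b → b < c → c < e →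
      F e - F a < 1 → F e - F a < 8 * δ → crD f^[k] a b c e ≤ K := by
  obtain ⟨B, hB, K, hK, h⟩ := hf.exists_crD_le
  refine ⟨Real.exp (B * 16) * ∏ _x ∈ C, K ^ 8, by positivity, ?_⟩
  intro δ Q k a b c e hs hk hab hbc hce h1 h8
  have hae : a < e := by linarith
  rw [crD_iterate hf.1.mono hab hbc hce]
  have hit := fun j => hf.1.mono.iterate j
  have hstep : ∀ j ∈ Finset.range k, crD f (f^[j] a) (f^[j] b) (f^[j] c) (f^[j] e) ≤
      Real.exp (B * (f^[j] e - f^[j] a)) *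
        ∏ x ∈ C, if ∃ p : ℤ, x + p ∈ Ioo (f^[j] a) (f^[j] e) then K else 1 := by
    intro j _
    have hlen : f^[j] e - f^[j] a < 1 := hF.sub_lt_one (by rw [hF.iterate, hF.iterate]; linarith)
    have hj := h _ _ _ _ (hit j hab) (hit j hbc) (hit j hce) (by linarith)
    have hw : ∀ x ∈ C, 1 ≤ if ∃ p : ℤ, x + p ∈ Ioo (f^[j] a) (f^[j] e) then K else 1 := by
      intro x _; split_ifs <;> linarith
    have hE : 1 ≤ Real.exp (B * (f^[j] e - f^[j] a)) :=
      Real.one_le_exp (mul_nonneg hB (sub_nonneg.2 (hit j hae).le))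
    by_cases hc : ∃ x ∈ C, ∃ p : ℤ, x + p ∈ Ioo (f^[j] a) (f^[j] e)
    · obtain ⟨x, hx, hp⟩ := hc
      refine (le_prod_of_le hw hx ?_).trans
        (le_mul_of_one_le_left (by linarith [one_le_prod_of_one_le hw]) hE)
      rw [if_pos hp]
      exact hj.1
    · push Not at hc
      refine (hj.2 (hf.deriv_ne_zero_of_forall fun x hx ⟨p, hp⟩ => hc x hx p hp)).trans
        (le_mul_of_one_le_right (by positivity) (one_le_prod_of_one_le hw))
  refine (Finset.prod_le_prod (fun j _ =>
    (crD_pos hf.1.mono (hit j hab) (hit j hbc) (hit j hce)).le) hstep).trans ?_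
  rw [Finset.prod_mul_distrib, ← Real.exp_sum, ← Finset.mul_sum, Finset.prod_comm]
  have hsum : ∑ j ∈ Finset.range k, (f^[j] e - f^[j] a) ≤ 16 :=
    (sum_iterate_length_le (m := 8) hf.1 hF hs hk hae h1 (by exact_mod_cast h8)).trans (by norm_num)
  refine mul_le_mul (Real.exp_le_exp.2 (mul_le_mul_of_nonneg_left hsum hB)) ?_
    (Finset.prod_nonneg fun x _ => Finset.prod_nonneg fun j _ => ?_) (by positivity)
  · refine Finset.prod_le_prod (fun x _ => Finset.prod_nonneg fun j _ => ?_) fun x _ => ?_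
    · split_ifs <;> linarith
    · refine prod_ite_le _ _ hK (hs.card_le_Ico (A := F x - F e) hk ?_)
      rintro j - ⟨p, hp⟩
      have h1 := hF.mono hp.1.le
      have h2 := hF.mono hp.2.le
      rw [hF.add_int, hF.iterate] at h1 h2
      push_cast
      exact ⟨p, by linarith, by linarith⟩
  · split_ifs <;> linarith

open Classical in
/-- Sharp bound for the distortion of an iterate on intervals whose images remain small. -/
lemma crD_iterate_le_of_small {ε B τ d a b c e : ℝ} (hf : IsMulticriticalLift f C dc)
    (hF : IsRotSemiconj f F ρ) (hFs : StrictMono F) (hd : 1 < d) (hB : 0 ≤ B)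
    (hε : ∀ a b c e, a < b → b < c → c < e → e - a < ε → StepBound f d B a b c e)
    (hs : RotSeparated ρ δ Q) (hk : k ≤ Q) (hab : a < b) (hbc : b < c) (hce : c < e)
    (hL : F b - F a ≤ 2 * δ) (hM : F c - F b ≤ δ) (hR : F e - F c ≤ 2 * δ) (hδ : 5 * δ < 1)
    (hτ0 : 0 ≤ τ) (hτε : τ ≤ ε) (hτ : ∀ j < k, f^[j] e - f^[j] a < τ) :
    crD f^[k] a b c e ≤ Real.exp (B * τ * 12) * (9 * d ^ 2) ^ (3 * C.card) := by
  have hae : a < e := by linarith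
  have hδ0 := hs.1
  rw [crD_iterate hf.1.mono hab hbc hce]
  have hit := fun j => hf.1.mono.iterate j
  have h9 : 1 ≤ 9 * d ^ 2 := by nlinarith
  have h3 : 1 ≤ 3 * d := by linarith
  let w1 : ℕ → ℝ → ℝ := fun j x =>
    if ∃ p : ℤ, x + p ∈ Ioo (f^[j] b) (f^[j] c) then 9 * d ^ 2 else 1
  let w2 : ℕ → ℝ → ℝ := fun j x => if ∃ p : ℤ, x + p ∈ Ioc (f^[j] a) (f^[j] b) then 3 * d else 1
  let w3 : ℕ → ℝ → ℝ := fun j x => if ∃ p : ℤ, x + p ∈ Ico (f^[j] c) (f^[j] e) then 3 * d else 1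
  have hw1 : ∀ j x, 1 ≤ w1 j x := fun j x => by simp only [w1]; split_ifs <;> linarith
  have hw2 : ∀ j x, 1 ≤ w2 j x := fun j x => by simp only [w2]; split_ifs <;> linarith
  have hw3 : ∀ j x, 1 ≤ w3 j x := fun j x => by simp only [w3]; split_ifs <;> linarith
  have hw : ∀ j x, 1 ≤ w1 j x * w2 j x * w3 j x := fun j x =>
    one_le_mul_of_one_le_of_one_le (one_le_mul_of_one_le_of_one_le (hw1 j x) (hw2 j x)) (hw3 j x)
  have hstep : ∀ j ∈ Finset.range k, crD f (f^[j] a) (f^[j] b) (f^[j] c) (f^[j] e) ≤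
      Real.exp (B * τ * (f^[j] e - f^[j] a)) * ∏ x ∈ C, w1 j x * w2 j x * w3 j x := by
    intro j hjk
    have hτj := hτ j (Finset.mem_range.1 hjk)
    have hpos : 0 < f^[j] e - f^[j] a := sub_pos.2 (hit j hae)
    have hj := hε _ _ _ _ (hit j hab) (hit j hbc) (hit j hce) (hτj.trans_le hτε)
    have hE : 1 ≤ Real.exp (B * τ * (f^[j] e - f^[j] a)) :=
      Real.one_le_exp (mul_nonneg (mul_nonneg hB (hpos.trans hτj).le) hpos.le)
    have hprod := one_le_prod_of_one_le (s := C) fun x _ => hw j x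
    have hcrit : ∀ x ∈ C, ∀ y ≤ w1 j x * w2 j x * w3 j x,
        y ≤ Real.exp (B * τ * (f^[j] e - f^[j] a)) * ∏ x ∈ C, w1 j x * w2 j x * w3 j x :=
      fun x hx y hy => (le_prod_of_le (fun x _ => hw j x) hx hy).trans
        (le_mul_of_one_le_left (by linarith) hE)
    by_cases hc : ∃ x ∈ C, ∃ p : ℤ, x + p ∈ Ioo (f^[j] a) (f^[j] e)
    · obtain ⟨x, hx, p, hp⟩ := hc
      have hx0 := hf.deriv_eq_zero hx p
      refine hcrit x hx _ ?_
      rcases le_or_gt (x + p) (f^[j] b) with hb | hb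
      · refine (hj.side _ (Or.inl ⟨hp.1, hb⟩) hx0).trans ?_
        have e2 : w2 j x = 3 * d := if_pos ⟨p, hp.1, hb⟩
        rw [← e2]
        exact (le_mul_of_one_le_left (by linarith [hw2 j x]) (hw1 j x)).trans
          (le_mul_of_one_le_right (by nlinarith [hw1 j x, hw2 j x]) (hw3 j x))
      rcases lt_or_ge (x + p) (f^[j] c) with hc | hc
      · refine (hj.mid _ ⟨hb, hc⟩ hx0).trans ?_
        have e1 : w1 j x = 9 * d ^ 2 := if_pos ⟨p, hb, hc⟩
        rw [← e1, mul_assoc]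
        exact le_mul_of_one_le_right (by linarith [hw1 j x])
          (one_le_mul_of_one_le_of_one_le (hw2 j x) (hw3 j x))
      · refine (hj.side _ (Or.inr ⟨hc, hp.2⟩) hx0).trans ?_
        have e3 : w3 j x = 3 * d := if_pos ⟨p, hc, hp.2⟩
        rw [← e3]
        exact le_mul_of_one_le_left (by linarith [hw3 j x])
          (one_le_mul_of_one_le_of_one_le (hw1 j x) (hw2 j x))
    · push Not at hc
      refine (hj.noncrit (hf.deriv_ne_zero_of_forall fun x hx ⟨p, hp⟩ => hc x hx p hp)).trans
        (le_trans ?_ (le_mul_of_one_le_right (by positivity) hprod))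
      refine Real.exp_le_exp.2 ?_
      rw [sq, ← mul_assoc]
      exact mul_le_mul_of_nonneg_right (mul_le_mul_of_nonneg_left hτj.le hB) hpos.le
  refine (Finset.prod_le_prod (fun j _ =>
    (crD_pos hf.1.mono (hit j hab) (hit j hbc) (hit j hce)).le) hstep).trans ?_
  rw [Finset.prod_mul_distrib, ← Real.exp_sum, ← Finset.mul_sum, Finset.prod_comm]
  have hsum : ∑ j ∈ Finset.range k, (f^[j] e - f^[j] a) ≤ 12 :=
    (sum_iterate_length_le (m := 6) hf.1 hF hs hk hae (by linarith)
      (by push_cast; linarith)).trans (by norm_num)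
  refine mul_le_mul (Real.exp_le_exp.2 (mul_le_mul_of_nonneg_left hsum (mul_nonneg hB hτ0))) ?_
    (Finset.prod_nonneg fun x _ => Finset.prod_nonneg fun j _ => by linarith [hw j x])
    (by positivity)
  rw [pow_mul, ← Finset.prod_const]
  refine Finset.prod_le_prod (fun x _ => Finset.prod_nonneg fun j _ => by linarith [hw j x])
    fun x _ => ?_
  rw [Finset.prod_mul_distrib, Finset.prod_mul_distrib]
  have c1 : ∏ j ∈ Finset.range k, w1 j x ≤ (9 * d ^ 2) ^ 1 := by
    refine prod_ite_le _ _ h9 (hs.card_le_Ico (A := F x - F c) hk ?_)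
    rintro j - ⟨p, hp⟩
    have h1 := hFs hp.1
    have h2 := hF.mono hp.2.le
    rw [hF.add_int, hF.iterate] at h1 h2
    push_cast
    exact ⟨p, by linarith, by linarith⟩
  have c2 : ∏ j ∈ Finset.range k, w2 j x ≤ (3 * d) ^ 2 := by
    refine prod_ite_le _ _ h3 (hs.card_le_Ico (A := F x - F b) hk ?_)
    rintro j - ⟨p, hp⟩
    have h1 := hFs hp.1
    have h2 := hF.mono hp.2
    rw [hF.add_int, hF.iterate] at h1 h2
    push_cast
    exact ⟨p, by linarith, by linarith⟩
  have c3 : ∏ j ∈ Finset.range k, w3 j x ≤ (3 * d) ^ 2 := by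
    refine prod_ite_le _ _ h3 (hs.card_le_Ioc (A := F x - F e) hk ?_)
    rintro j - ⟨p, hp⟩
    have h1 := hF.mono hp.1
    have h2 := hFs hp.2
    rw [hF.add_int, hF.iterate] at h1 h2
    push_cast
    exact ⟨p, by linarith, by linarith⟩
  have p1 := Finset.prod_nonneg (s := Finset.range k) fun j _ => (zero_le_one.trans (hw1 j x))
  have p2 := Finset.prod_nonneg (s := Finset.range k) fun j _ => (zero_le_one.trans (hw2 j x))
  have p3 := Finset.prod_nonneg (s := Finset.range k) fun j _ => (zero_le_one.trans (hw3 j x))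
  refine (mul_le_mul (mul_le_mul c1 c2 p2 (by positivity)) c3 p3 (by positivity)).trans
    (le_of_eq (by ring))

end Products

/-! ### Return intervals with definite space on both sides -/

section Returns

variable {f F : ℝ → ℝ} {ρ δ δ' a b c e : ℝ} {q Q : ℕ} {p P : ℤ}

lemma IsRotSemiconj.iterate_add_int (hF : IsRotSemiconj f F ρ) (j : ℕ) (x : ℝ) (m : ℤ) :
    F (f^[j] x + m) = F x + j * ρ + m := by
  rw [hF.add_int, hF.iterate]

lemma IsCircleMapLift.iterate_surjective (hf : IsCircleMapLift f) (j : ℕ) :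
    Function.Surjective f^[j] :=
  hf.surjective.iterate j

lemma IsRotSemiconj.iterate_le_of_le (hf : IsCircleMapLift f) (hF : IsRotSemiconj f F ρ) {s : ℝ}
    (ha : ∀ x, s ≤ F x → a ≤ x) {m : ℕ} {y : ℝ} (hy : s + m * ρ ≤ F y) : f^[m] a ≤ y := by
  obtain ⟨x, rfl⟩ := hf.iterate_surjective m y
  rw [hF.iterate] at hy
  exact (hf.mono.iterate m).monotone (ha x (by linarith))

lemma IsRotSemiconj.le_iterate_of_le (hf : IsCircleMapLift f) (hF : IsRotSemiconj f F ρ) {s : ℝ}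
    (he : ∀ x, F x ≤ s → x ≤ e) {m : ℕ} {y : ℝ} (hy : F y ≤ s + m * ρ) : y ≤ f^[m] e := by
  obtain ⟨x, rfl⟩ := hf.iterate_surjective m y
  rw [hF.iterate] at hy
  exact (hf.mono.iterate m).monotone (he x (by linarith))

/-- If every iterate of `[b, c]` up to time `Q` has other iterates close to it on both sides, then
the shortest of these iterates has definite space on both sides. -/
lemma exists_quarter_le_crossRatio_of_nbrs (hf : IsCircleMapLift f) (hF : IsRotSemiconj f F ρ)
    (hbc : b < c) {s t : ℝ} (ha : ∀ x, F b - s ≤ F x → a ≤ x) (he : ∀ x, F x ≤ F c + t → x ≤ e)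
    (hleft : ∀ m ≤ Q, ∃ m' ≤ Q, ∃ p : ℤ, f^[m'] c + p ≤ f^[m] b ∧ m * ρ - s ≤ m' * ρ + p)
    (hright : ∀ m ≤ Q, ∃ m' ≤ Q, ∃ p : ℤ, f^[m] c ≤ f^[m'] b + p ∧ m' * ρ + p ≤ m * ρ + t) :
    ∃ m ≤ Q, 1 / 4 ≤ crossRatio (f^[m] a) (f^[m] b) (f^[m] c) (f^[m] e) := by
  obtain ⟨m, hm, hmin⟩ := (Finset.range (Q + 1)).exists_min_image
    (fun m => f^[m] c - f^[m] b) ⟨0, by simp⟩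
  rw [Finset.mem_range] at hm
  obtain ⟨m₁, hm₁, p₁, hl, hl'⟩ := hleft m (by omega)
  obtain ⟨m₂, hm₂, p₂, hr, hr'⟩ := hright m (by omega)
  refine ⟨m, by omega, quarter_le_crossRatio (hf.mono.iterate m hbc) ?_ ?_⟩
  · have h1 := hmin m₁ (by simp; omega)
    have h2 : f^[m] a ≤ f^[m₁] b + p₁ :=
      hF.iterate_le_of_le hf ha (by rw [hF.iterate_add_int]; linarith)
    linarith
  · have h1 := hmin m₂ (by simp; omega)
    have h2 : f^[m₂] c + p₂ ≤ f^[m] e :=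
      hF.le_iterate_of_le hf he (by rw [hF.iterate_add_int]; linarith)
    linarith

lemma exists_quarter_le_crossRatio_of_pos (hf : IsCircleMapLift f) (hF : IsRotSemiconj f F ρ)
    (hqQ : q ≤ Q) (hδ' : 0 < δ') (hq : q * ρ - p = δ) (hQ : Q * ρ - P = -δ')
    (hbc : b < c) (hc : c = f^[q] b - p)
    (ha : ∀ x, F b - (δ + δ') ≤ F x → a ≤ x) (he : ∀ x, F x ≤ F c + (δ + δ') → x ≤ e) :
    ∃ m ≤ Q, 1 / 4 ≤ crossRatio (f^[m] a) (f^[m] b) (f^[m] c) (f^[m] e) := by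
  have hc' : c = f^[q] b + ((-p : ℤ) : ℝ) := by rw [hc]; push_cast; ring
  have hFc : F c = F b + δ := by rw [hc', hF.iterate_add_int, ← hq]; push_cast; ring
  have hadj : ∀ m, f^[m] c = f^[m + q] b - p := by
    intro m
    rw [hc', hf.iterate_add_int, ← Function.iterate_add_apply]; push_cast; ring
  refine exists_quarter_le_crossRatio_of_nbrs hf hF hbc ha he ?_ ?_
  · intro m hm
    rcases le_or_gt q m with h | h
    · refine ⟨m - q, by omega, p, ?_, ?_⟩
      · rw [hadj, Nat.sub_add_cancel h]; linarith
      · rw [Nat.cast_sub h]; linarith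
    · have hcast : ((m + Q - q : ℕ) : ℝ) = m + Q - q := by
        rw [Nat.cast_sub (by omega)]; push_cast; ring
      refine ⟨m + Q - q, by omega, p - P, (hF.lt_of_lt ?_).le, ?_⟩
      · rw [hF.iterate_add_int, hF.iterate, hcast]; push_cast; linarith
      · rw [hcast]; push_cast; linarith
  · intro m hm
    rcases le_or_gt (m + q) Q with h | h
    · refine ⟨m + q, h, -p, ?_, ?_⟩
      · rw [hadj]; push_cast; linarith
      · push_cast; linarith
    · have hcast : ((m + q - Q : ℕ) : ℝ) = m + q - Q := by
        rw [Nat.cast_sub (by omega)]; push_cast; ring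
      refine ⟨m + q - Q, by omega, P - p, (hF.lt_of_lt ?_).le, ?_⟩
      · rw [hF.iterate_add_int, hF.iterate, hcast]; push_cast; linarith
      · rw [hcast]; push_cast; linarith

lemma exists_quarter_le_crossRatio_of_neg (hf : IsCircleMapLift f) (hF : IsRotSemiconj f F ρ)
    (hqQ : q ≤ Q) (hδ' : 0 < δ') (hq : q * ρ - p = -δ) (hQ : Q * ρ - P = δ')
    (hbc : b < c) (hb : b = f^[q] c - p)
    (ha : ∀ x, F b - (δ + δ') ≤ F x → a ≤ x) (he : ∀ x, F x ≤ F c + (δ + δ') → x ≤ e) :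
    ∃ m ≤ Q, 1 / 4 ≤ crossRatio (f^[m] a) (f^[m] b) (f^[m] c) (f^[m] e) := by
  have hb' : b = f^[q] c + ((-p : ℤ) : ℝ) := by rw [hb]; push_cast; ring
  have hFb : F b = F c - δ := by
    rw [hb', hF.iterate_add_int, show δ = -(q * ρ - p) by linarith]; push_cast; ring
  have hadj : ∀ m, f^[m] b = f^[m + q] c - p := by
    intro m
    rw [hb', hf.iterate_add_int, ← Function.iterate_add_apply]; push_cast; ring
  refine exists_quarter_le_crossRatio_of_nbrs hf hF hbc ha he ?_ ?_
  · intro m hm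
    rcases le_or_gt (m + q) Q with h | h
    · refine ⟨m + q, h, -p, ?_, ?_⟩
      · rw [hadj]; push_cast; linarith
      · push_cast; linarith
    · have hcast : ((m + q - Q : ℕ) : ℝ) = m + q - Q := by
        rw [Nat.cast_sub (by omega)]; push_cast; ring
      refine ⟨m + q - Q, by omega, P - p, (hF.lt_of_lt ?_).le, ?_⟩
      · rw [hF.iterate_add_int, hF.iterate, hcast]; push_cast; linarith
      · rw [hcast]; push_cast; linarith
  · intro m hm
    rcases le_or_gt q m with h | h
    · refine ⟨m - q, by omega, p, ?_, ?_⟩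
      · rw [hadj, Nat.sub_add_cancel h]; linarith
      · rw [Nat.cast_sub h]; linarith
    · have hcast : ((m + Q - q : ℕ) : ℝ) = m + Q - q := by
        rw [Nat.cast_sub (by omega)]; push_cast; ring
      refine ⟨m + Q - q, by omega, p - P, (hF.lt_of_lt ?_).le, ?_⟩
      · rw [hF.iterate_add_int, hF.iterate, hcast]; push_cast; linarith
      · rw [hcast]; push_cast; linarith

/-- Some iterate, up to time `q_{n+1}`, of an arc `I_n(x) = [b, c]` has definite space inside the
image of `[a, e]`, provided `[a, e]` extends it on both sides by at least `I_n` and `I_{n+1}`. -/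
lemma exists_quarter_le_crossRatio (hf : IsCircleMapLift f) (hF : IsRotSemiconj f F ρ)
    (hirr : Irrational ρ) (hρ : ρ ∈ Ioo (0 : ℝ) 1) (n : ℕ) (hbc : b < c)
    (hM : (0 < convErr ρ n ∧ c = retPt f ρ b n) ∨ (convErr ρ n < 0 ∧ b = retPt f ρ c n))
    (ha : ∀ x, F b - (convGap ρ n + convGap ρ (n + 1)) ≤ F x → a ≤ x)
    (he : ∀ x, F x ≤ F c + (convGap ρ n + convGap ρ (n + 1)) → x ≤ e) :
    ∃ m ≤ qden ρ (n + 1), 1 / 4 ≤ crossRatio (f^[m] a) (f^[m] b) (f^[m] c) (f^[m] e) := by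
  have hg := convGap_pos hirr hρ n
  have hg' := convGap_pos hirr hρ (n + 1)
  have hle := qden_le_succ hirr hρ n
  have hQ : ((qden ρ (n + 1) : ℕ) : ℝ) * ρ - ((pnum ρ (n + 1) : ℤ) : ℝ) = convErr ρ (n + 1) := by
    simp [convErr]
  have hq : ((qden ρ n : ℕ) : ℝ) * ρ - ((pnum ρ n : ℤ) : ℝ) = convErr ρ n := by
    simp [convErr]
  rcases convErr_sign hirr hρ n with ⟨h1, h2⟩ | ⟨h1, h2⟩
  · rcases hM with ⟨-, hM⟩ | ⟨hM, -⟩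
    · exact exists_quarter_le_crossRatio_of_pos hf hF hle hg' (hq.trans h1) (hQ.trans h2) hbc
        (by simpa [retPt] using hM) ha he
    · linarith
  · rcases hM with ⟨hM, -⟩ | ⟨-, hM⟩
    · linarith
    · exact exists_quarter_le_crossRatio_of_neg hf hF hle hg' (hq.trans h1) (hQ.trans h2) hbc
        (by simpa [retPt] using hM) ha he

end Returns

/-! ### Absence of wandering intervals -/

section Wandering

variable {f F : ℝ → ℝ} {C : Finset ℝ} {dc : ℝ → ℝ} {ρ : ℝ}

lemma rotSeparated_convGap (hirr : Irrational ρ) (hρ : ρ ∈ Ioo (0 : ℝ) 1) (n : ℕ) :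
    RotSeparated ρ (convGap ρ n) (qden ρ (n + 1)) :=
  ⟨convGap_pos hirr hρ n, fun _ hj0 hj p => convGap_le_abs hirr hρ n hj0 hj p⟩

lemma crossRatio_le_div {a b c e : ℝ} (hab : a < b) (hbc : b < c) (hce : c < e) :
    crossRatio a b c e ≤ (e - c) / (c - b) := by
  unfold crossRatio
  rw [div_le_div_iff₀ (mul_pos (by linarith) (by linarith)) (by linarith)]
  have : (b - a) * (c - b) ≤ (c - a) * (e - b) :=
    mul_le_mul (by linarith) (by linarith) (by linarith) (by linarith)
  nlinarith

lemma IsRotSemiconj.map_retPt (hF : IsRotSemiconj f F ρ) (x : ℝ) (n : ℕ) :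
    F (retPt f ρ x n) = F x + convErr ρ n := by
  have := hF.iterate_add_int (qden ρ n) x (-(pnum ρ n : ℤ))
  push_cast at this
  rw [retPt, sub_eq_add_neg, this, convErr]
  ring

/-- The endpoints of an arc `I_n` with prescribed image under `F`. -/
lemma IsRotSemiconj.exists_arc (hF : IsRotSemiconj f F ρ) (hirr : Irrational ρ)
    (hρ : ρ ∈ Ioo (0 : ℝ) 1) (n : ℕ) (s : ℝ) :
    ∃ b c, F b = s ∧ F c = s + convGap ρ n ∧
      ((0 < convErr ρ n ∧ c = retPt f ρ b n) ∨
        (convErr ρ n < 0 ∧ b = retPt f ρ c n)) := by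
  have hg := convGap_pos hirr hρ n
  rcases convErr_sign hirr hρ n with ⟨h, -⟩ | ⟨h, -⟩
  · obtain ⟨b, hb⟩ := hF.surj s
    exact ⟨b, _, hb, by rw [hF.map_retPt, hb, h], Or.inl ⟨by linarith, rfl⟩⟩
  · obtain ⟨c, hc⟩ := hF.surj (s + convGap ρ n)
    exact ⟨_, c, by rw [hF.map_retPt, hc, h]; ring, hc, Or.inr ⟨by linarith, rfl⟩⟩

lemma IsMulticriticalLift.injective_rotSemiconj (hf : IsMulticriticalLift f C dc)
    (hF : IsRotSemiconj f F ρ) (hirr : Irrational ρ) (hρ : ρ ∈ Ioo (0 : ℝ) 1) : StrictMono F := by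
  intro α β₀ hlt
  refine lt_of_le_of_ne (hF.mono hlt.le) fun hαβ => ?_
  obtain ⟨K, hK, hcr⟩ := hf.exists_crD_iterate_le hF
  have hbdd : BddAbove {x | F x = F α} := by
    refine ⟨α + 1, fun x (hx : F x = F α) => (hF.lt_of_lt ?_).le⟩
    rw [hF.add_one, hx]
    linarith
  set β := sSup {x | F x = F α} with hβ
  have hβα : α < β := hlt.trans_le (le_csSup hbdd hαβ.symm)
  set γ := (β - α) / (8 * K) with hγ
  have hγ0 : 0 < γ := div_pos (by linarith) (by linarith)
  have hη : F α < F (β + γ) := by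
    refine lt_of_le_of_ne (hF.mono (by linarith)) fun h => ?_
    have := le_csSup hbdd (show β + γ ∈ {x | F x = F α} from h.symm)
    linarith
  obtain ⟨n, hn⟩ := ((tendsto_order.1 (tendsto_convGap hirr hρ)).2
    (min (1 / 8) ((F (β + γ) - F α) / 4)) (lt_min (by norm_num) (by linarith))).exists
  have hn1 := hn.trans_le (min_le_left _ _)
  have hn2 := hn.trans_le (min_le_right _ _)
  have hδ := convGap_pos hirr hρ n
  have hδ' := convGap_succ_lt hirr hρ n
  set δ := convGap ρ n
  obtain ⟨b, c, hb, hc, hM⟩ := hF.exists_arc hirr hρ n (F α - δ / 2)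
  obtain ⟨a, ha⟩ := hF.surj (F b - 3 * δ)
  obtain ⟨e, he⟩ := hF.surj (F c + 3 * δ)
  have hab : a < b := hF.lt_of_lt (by linarith)
  have hbα : b < α := hF.lt_of_lt (by linarith)
  have hce : c < e := hF.lt_of_lt (by linarith)
  have hβc : β ≤ c := csSup_le ⟨α, rfl⟩ fun x (hx : F x = F α) =>
    (hF.lt_of_lt (by linarith)).le
  have heγ : e < β + γ := hF.lt_of_lt (by linarith)
  have hbc : b < c := by linarith
  obtain ⟨m, hm, hq⟩ := exists_quarter_le_crossRatio hf.1 hF hirr hρ n hbc hM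
    (a := a) (e := e) (fun x hx => (hF.lt_of_lt (by linarith)).le)
    (fun x hx => (hF.lt_of_lt (by linarith)).le)
  have hD := hcr δ _ m a b c e (rotSeparated_convGap hirr hρ n) hm hab hbc hce
    (by linarith) (by linarith)
  rw [crD, div_le_iff₀ (crossRatio_pos hab hbc hce)] at hD
  have h1 := mul_le_mul_of_nonneg_left (crossRatio_le_div hab hbc hce) hK.le
  have h2 : (1 / 4) * (c - b) ≤ K * (e - c) := by
    rw [← mul_div_assoc] at h1
    have h3 := (hq.trans hD).trans h1
    rwa [le_div_iff₀ (by linarith)] at h3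
  have h3 : K * (e - c) ≤ K * γ := mul_le_mul_of_nonneg_left (by linarith) hK.le
  have h4 : K * γ = (β - α) / 8 := by rw [hγ]; field_simp
  linarith

lemma IsRotSemiconj.exists_forall_sub_lt (hF : IsRotSemiconj f F ρ) (hFs : StrictMono F) {τ : ℝ}
    (hτ : 0 < τ) : ∃ η > 0, ∀ x y, F y - F x < η → y - x < τ := by
  have hcont := hF.mono.continuous_of_surjective hF.surj
  obtain ⟨x₀, -, hmin⟩ := isCompact_Icc.exists_isMinOn (nonempty_Icc.2 (zero_le_one (α := ℝ)))
    (f := fun x => F (x + τ) - F x) (by fun_prop)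
  refine ⟨F (x₀ + τ) - F x₀, sub_pos.2 (hFs (by linarith)), fun x y h => ?_⟩
  by_contra! hxy
  have h1 : F (x₀ + τ) - F x₀ ≤ F (Int.fract x + τ) - F (Int.fract x) :=
    hmin ⟨Int.fract_nonneg x, (Int.fract_lt_one x).le⟩
  have h2 : F x = F (Int.fract x) + ⌊x⌋ := by rw [← hF.add_int, Int.fract_add_floor]
  have h3 : F (x + τ) = F (Int.fract x + τ) + ⌊x⌋ := by
    rw [← hF.add_int]; congr 1; rw [Int.fract]; ring
  have h4 := hF.mono (show x + τ ≤ y by linarith)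
  linarith

end Wandering

/-! ### Atoms of the dynamical partitions -/

section Atoms

variable {f F : ℝ → ℝ} {ρ : ℝ} {n : ℕ}

/-- The generation of an atom of `𝒫ₙ`. -/
def atomGen (ρ : ℝ) (n : ℕ) : AtomIdx ρ n → ℕ :=
  Sum.elim (fun _ => n) fun _ => n + 1

/-- The time at which an atom of `𝒫ₙ` appears. -/
def atomTime (ρ : ℝ) (n : ℕ) : AtomIdx ρ n → ℕ :=
  Sum.elim (fun i => i.1) fun j => j.1

lemma atomL_eq (f : ℝ → ℝ) (x : ℝ) (A : AtomIdx ρ n) :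
    atomL f ρ x n A =
      min (f^[atomTime ρ n A] x) (f^[atomTime ρ n A] (retPt f ρ x (atomGen ρ n A))) := by
  cases A <;> rfl

lemma atomR_eq (f : ℝ → ℝ) (x : ℝ) (A : AtomIdx ρ n) :
    atomR f ρ x n A =
      max (f^[atomTime ρ n A] x) (f^[atomTime ρ n A] (retPt f ρ x (atomGen ρ n A))) := by
  cases A <;> rfl

lemma atomTime_lt (hirr : Irrational ρ) (hρ : ρ ∈ Ioo (0 : ℝ) 1) (A : AtomIdx ρ n) :
    atomTime ρ n A < qden ρ (n + 1) := by
  rcases A with i | j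
  · exact i.2
  · exact j.2.trans_le (qden_le_succ hirr hρ n)

lemma convGap_atomGen_le (hirr : Irrational ρ) (hρ : ρ ∈ Ioo (0 : ℝ) 1) (A : AtomIdx ρ n) :
    convGap ρ (atomGen ρ n A) ≤ convGap ρ n := by
  refine convGap_antitone hirr hρ ?_
  rcases A with i | j
  · exact le_rfl
  · exact Nat.le_succ n

lemma IsCircleMapLift.iterate_retPt (hf : IsCircleMapLift f) (x : ℝ) (i ν : ℕ) :
    f^[i] (retPt f ρ x ν) = retPt f ρ (f^[i] x) ν := by
  have := hf.iterate_add_int i (f^[qden ρ ν] x) (-(pnum ρ ν : ℤ))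
  push_cast at this
  rw [retPt, retPt, sub_eq_add_neg, this, ← Function.iterate_add_apply, add_comm i,
    Function.iterate_add_apply, sub_eq_add_neg]

lemma IsRotSemiconj.map_atomL (hF : IsRotSemiconj f F ρ) (x : ℝ) (A : AtomIdx ρ n) :
    F (atomL f ρ x n A) =
      F x + atomTime ρ n A * ρ + min 0 (convErr ρ (atomGen ρ n A)) := by
  rw [atomL_eq, hF.mono.map_min, hF.iterate, hF.iterate, hF.map_retPt, ← min_add_add_left]
  congr 1 <;> ring

lemma IsRotSemiconj.map_atomR (hF : IsRotSemiconj f F ρ) (x : ℝ) (A : AtomIdx ρ n) :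
    F (atomR f ρ x n A) =
      F x + atomTime ρ n A * ρ + max 0 (convErr ρ (atomGen ρ n A)) := by
  rw [atomR_eq, hF.mono.map_max, hF.iterate, hF.iterate, hF.map_retPt, ← max_add_add_left]
  congr 1 <;> ring

lemma max_sub_min_convErr (ρ : ℝ) (ν : ℕ) :
    max 0 (convErr ρ ν) - min 0 (convErr ρ ν) = convGap ρ ν := by
  rw [max_sub_min_eq_abs, sub_zero, convGap]

lemma IsRotSemiconj.map_atomR_sub_map_atomL (hF : IsRotSemiconj f F ρ) (x : ℝ) (A : AtomIdx ρ n) :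
    F (atomR f ρ x n A) - F (atomL f ρ x n A) = convGap ρ (atomGen ρ n A) := by
  rw [hF.map_atomR, hF.map_atomL, ← max_sub_min_convErr]
  ring

lemma IsRotSemiconj.atomL_lt_atomR (hF : IsRotSemiconj f F ρ) (hirr : Irrational ρ)
    (hρ : ρ ∈ Ioo (0 : ℝ) 1) (x : ℝ) (A : AtomIdx ρ n) :
    atomL f ρ x n A < atomR f ρ x n A :=
  hF.lt_of_lt (by linarith [hF.map_atomR_sub_map_atomL x A, convGap_pos hirr hρ (atomGen ρ n A)])

lemma atom_eq_retPt (hf : IsCircleMapLift f) (hF : IsRotSemiconj f F ρ) (hirr : Irrational ρ)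
    (hρ : ρ ∈ Ioo (0 : ℝ) 1) (x : ℝ) (A : AtomIdx ρ n) :
    (0 < convErr ρ (atomGen ρ n A) ∧
        atomR f ρ x n A = retPt f ρ (atomL f ρ x n A) (atomGen ρ n A)) ∨
      (convErr ρ (atomGen ρ n A) < 0 ∧
        atomL f ρ x n A = retPt f ρ (atomR f ρ x n A) (atomGen ρ n A)) := by
  rw [atomL_eq, atomR_eq, hf.iterate_retPt]
  have hy := hF.map_retPt (f^[atomTime ρ n A] x) (atomGen ρ n A)
  rcases (convErr_ne_zero hirr hρ (atomGen ρ n A)).lt_or_gt with h | h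
  · have := (hF.lt_of_lt (show F (retPt f ρ (f^[atomTime ρ n A] x) (atomGen ρ n A)) <
      F (f^[atomTime ρ n A] x) by linarith)).le
    exact Or.inr ⟨h, by rw [min_eq_right this, max_eq_left this]⟩
  · have := (hF.lt_of_lt (show F (f^[atomTime ρ n A] x) <
      F (retPt f ρ (f^[atomTime ρ n A] x) (atomGen ρ n A)) by linarith)).le
    exact Or.inl ⟨h, by rw [min_eq_left this, max_eq_right this]⟩

lemma IsRotSemiconj.map_atomL_sub_leftNbr (hF : IsRotSemiconj f F ρ) {x : ℝ} {A Δ : AtomIdx ρ n}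
    (h : IsLeftNbr f ρ x n A Δ) :
    F (atomL f ρ x n Δ) - F (atomL f ρ x n Δ - atomLen f ρ x n A) =
      convGap ρ (atomGen ρ n A) := by
  obtain ⟨-, m, hm⟩ := h
  have h1 : atomL f ρ x n Δ - atomLen f ρ x n A + m = atomL f ρ x n A := by
    rw [atomLen, hm]; ring
  have h2 := hF.add_int (atomL f ρ x n Δ - atomLen f ρ x n A) m
  have h3 := hF.add_int (atomL f ρ x n Δ) m
  rw [h1] at h2
  rw [← hm] at h3
  linarith [hF.map_atomR_sub_map_atomL x A]

lemma IsRotSemiconj.map_rightNbr_sub_atomR (hF : IsRotSemiconj f F ρ) {x : ℝ} {A Δ : AtomIdx ρ n}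
    (h : IsRightNbr f ρ x n A Δ) :
    F (atomR f ρ x n Δ + atomLen f ρ x n A) - F (atomR f ρ x n Δ) =
      convGap ρ (atomGen ρ n A) := by
  obtain ⟨-, m, hm⟩ := h
  have h1 : atomR f ρ x n Δ + atomLen f ρ x n A + m = atomR f ρ x n A := by
    rw [atomLen, hm]; ring
  have h2 := hF.add_int (atomR f ρ x n Δ + atomLen f ρ x n A) m
  have h3 := hF.add_int (atomR f ρ x n Δ) m
  rw [h1] at h2
  rw [← hm] at h3
  linarith [hF.map_atomR_sub_map_atomL x A]

/-- The base point does not lie in the interior of an atom. -/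
lemma IsRotSemiconj.base_notMem_Ioo (hF : IsRotSemiconj f F ρ) (hirr : Irrational ρ)
    (hρ : ρ ∈ Ioo (0 : ℝ) 1) (x : ℝ) (E : AtomIdx ρ n) (p : ℤ) :
    F x + p ∉ Ioo (F (atomL f ρ x n E)) (F (atomR f ρ x n E)) := by
  rintro ⟨h1, h2⟩
  rw [hF.map_atomL] at h1
  rw [hF.map_atomR] at h2
  have hg := convGap_atomGen_le hirr hρ E
  have hsub := max_sub_min_convErr ρ (atomGen ρ n E)
  have hmin := min_le_left 0 (convErr ρ (atomGen ρ n E))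
  have hmax := le_max_left 0 (convErr ρ (atomGen ρ n E))
  have habs : |atomTime ρ n E * ρ - p| < convGap ρ (atomGen ρ n E) := by
    rw [abs_lt]; constructor <;> linarith
  by_cases h0 : atomTime ρ n E = 0
  · rw [h0] at habs h1 h2
    have hp : p = 0 := by
      have h3 : |(p : ℝ)| < 1 := by
        have := habs.trans_le (hg.trans (convGap_lt_one hirr hρ n).le)
        simpa using this
      rw [← Int.abs_lt_one_iff]
      exact_mod_cast h3
    rw [hp] at h1 h2
    push_cast at h1 h2
    rcases le_total 0 (convErr ρ (atomGen ρ n E)) with h | h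
    · rw [min_eq_left h] at h1; linarith
    · rw [max_eq_left h] at h2; linarith
  · have := convGap_le_abs hirr hρ n (j := atomTime ρ n E) (by exact_mod_cast h0)
      (by rw [Nat.abs_cast]; exact_mod_cast atomTime_lt hirr hρ E) p
    push_cast at this
    linarith

/-- A long atom does not meet the base point before time `q_{n+1}`. -/
lemma IsRotSemiconj.le_qden_of_imgInAtom (hF : IsRotSemiconj f F ρ)
    (hirr : Irrational ρ) (hρ : ρ ∈ Ioo (0 : ℝ) 1) {x : ℝ} {k : ℕ}
    (i : {i : ℕ // i < qden ρ (n + 1)})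
    (h : ∀ j : ℕ, 1 ≤ j → j ≤ k → ImgInAtom f ρ x n j (Sum.inl i)) : k ≤ qden ρ (n + 1) := by
  by_contra! hk
  have hi := i.2
  obtain ⟨E, m, hl, hr⟩ := h (qden ρ (n + 1) - i.1) (by omega) (by omega)
  replace hl := hF.mono hl
  replace hr := hF.mono hr
  rw [hF.add_int, hF.iterate, hF.map_atomL x (Sum.inl i), Nat.cast_sub hi.le] at hl
  rw [hF.add_int, hF.iterate, hF.map_atomR x (Sum.inl i), Nat.cast_sub hi.le] at hr
  simp only [atomTime, atomGen, Sum.elim_inl] at hl hr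
  have hQ : (qden ρ (n + 1) : ℝ) * ρ = pnum ρ (n + 1) + convErr ρ (n + 1) := by
    rw [convErr]; ring
  have hg := convGap_succ_lt hirr hρ n
  have hg' := convGap_pos hirr hρ (n + 1)
  refine hF.base_notMem_Ioo hirr hρ x E (pnum ρ (n + 1) - m) ⟨?_, ?_⟩
  · push_cast
    rcases convErr_sign hirr hρ n with ⟨h1, h2⟩ | ⟨h1, h2⟩ <;>
      linarith [min_le_left 0 (convErr ρ n), min_le_right 0 (convErr ρ n)]
  · push_cast
    rcases convErr_sign hirr hρ n with ⟨h1, h2⟩ | ⟨h1, h2⟩ <;>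
      linarith [le_max_left 0 (convErr ρ n), le_max_right 0 (convErr ρ n)]

/-- Two distinct short atoms are never adjacent. -/
lemma IsRotSemiconj.not_sameCirclePt_inr (hF : IsRotSemiconj f F ρ) (hirr : Irrational ρ)
    (hρ : ρ ∈ Ioo (0 : ℝ) 1) {x : ℝ} {i j : {j : ℕ // j < qden ρ n}} (hij : i ≠ j) :
    ¬ SameCirclePt (atomR f ρ x n (Sum.inr i)) (atomL f ρ x n (Sum.inr j)) := by
  rintro ⟨m, hm⟩
  replace hm := congrArg F hm
  rw [hF.add_int, hF.map_atomL, hF.map_atomR] at hm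
  simp only [atomTime, atomGen, Sum.elim_inr] at hm
  have hi := i.2
  have hj := j.2
  have hle := qden_le_succ hirr hρ n
  have h := convGap_le_abs hirr hρ n (j := (i.1 : ℤ) - j.1)
    (sub_ne_zero.2 fun h => hij (Subtype.ext (by exact_mod_cast h))) (by rw [abs_lt]; omega) m
  have hsub := max_sub_min_convErr ρ (n + 1)
  push_cast at h
  rw [show ((i.1 : ℝ) - j.1) * ρ - m = -convGap ρ (n + 1) by linarith, abs_neg,
    abs_of_pos (convGap_pos hirr hρ _)] at h
  linarith [convGap_succ_lt hirr hρ n]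

end Atoms

/-! ### The universal bound -/

section Universal

variable {f F : ℝ → ℝ} {ρ : ℝ} {n : ℕ}

/-- If all iterates up to time `q_{n+1}` have cross-ratio distortion at most `D` on intervals of
combinatorial size `|I_n|` with sides twice as long, then every iterate has cross-ratio distortion
at most `4 D` on intervals of this size having long enough sides. -/
lemma crD_iterate_le_of_long_sides {D a b c e : ℝ} (hf : IsCircleMapLift f)
    (hF : IsRotSemiconj f F ρ) (hFs : StrictMono F) (hirr : Irrational ρ) (hρ : ρ ∈ Ioo (0 : ℝ) 1)
    (hbc : b < c)
    (hD : ∀ m ≤ qden ρ (n + 1), ∀ a e, a < b → c < e → F b - F a ≤ 2 * convGap ρ n →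
      F e - F c ≤ 2 * convGap ρ n → crD f^[m] a b c e ≤ D)
    (hM : (0 < convErr ρ n ∧ c = retPt f ρ b n) ∨ (convErr ρ n < 0 ∧ b = retPt f ρ c n))
    (hL : convGap ρ n + convGap ρ (n + 1) ≤ F b - F a)
    (hR : convGap ρ n + convGap ρ (n + 1) ≤ F e - F c) (k : ℕ) : crD f^[k] a b c e ≤ 4 * D := by
  have hg := convGap_pos hirr hρ n
  have hg' := convGap_pos hirr hρ (n + 1)
  have hlt := convGap_succ_lt hirr hρ n
  obtain ⟨a', ha'⟩ := hF.surj (F b - (convGap ρ n + convGap ρ (n + 1)))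
  obtain ⟨e', he'⟩ := hF.surj (F c + (convGap ρ n + convGap ρ (n + 1)))
  have haa : a ≤ a' := hFs.le_iff_le.1 (by linarith)
  have hee : e' ≤ e := hFs.le_iff_le.1 (by linarith)
  have hab : a' < b := hF.lt_of_lt (by linarith)
  have hce : c < e' := hF.lt_of_lt (by linarith)
  obtain ⟨m, hm, hq⟩ := exists_quarter_le_crossRatio hf hF hirr hρ n hbc hM
    (fun x hx => hFs.le_iff_le.1 (ha'.trans_le hx))
    (fun x hx => hFs.le_iff_le.1 (hx.trans_eq he'.symm))
  have hpos := crossRatio_pos hab hbc hce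
  have hDm := hD m hm a' e' hab hce (by linarith) (by linarith)
  rw [crD, div_le_iff₀ hpos] at hDm
  have hit := hf.mono.iterate k
  have hmono := crossRatio_mono haa hab hbc hce hee
  have hD0 : 0 < D := pos_of_mul_pos_left (by linarith) hpos.le
  rw [crD, div_le_iff₀ (hpos.trans_le hmono)]
  refine (crossRatio_le_one (hit (haa.trans_lt hab)) (hit hbc) (hit (hce.trans_le hee))).trans ?_
  nlinarith

end Universal

end MCircle

/-- **Universal cross-ratio inequality** (Theorem B). Given `N ≥ 1` and `d > 1` there
is `B = B(N,d) > 1` (in fact one may take `B = (3/2)^{2(3N+1)} (9d²)^{3N}`) such that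
for every multicritical circle map `f` with irrational rotation number, having at most
`N` critical points with criticalities at most `d`, there is `n₀ = n₀(f)` such that for
all `n ≥ n₀`, every atom `Δ` of `𝒫ₙ` (with left neighbour `A` and right neighbour `B'`,
so that `Δ* = A ∪ Δ ∪ B'`) and every `k` such that `f^j(Δ)` is contained in an element
of `𝒫ₙ` for all `1 ≤ j ≤ k`, one has `CrD(f^k; Δ, Δ*) ≤ B`. -/
theorem crD_universal (N : ℕ) (hN : 1 ≤ N) (d : ℝ) (hd : 1 < d) :
    ∃ B : ℝ, 1 < B ∧ B = (3 / 2 : ℝ) ^ (2 * (3 * N + 1)) * (9 * d ^ 2) ^ (3 * N) ∧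
      ∀ (f : ℝ → ℝ) (C : Finset ℝ) (dc : ℝ → ℝ) (ρ c₀ : ℝ),
        GoodMap f C dc ρ → C.card ≤ N → (∀ c ∈ C, dc c ≤ d) → c₀ ∈ C →
        ∃ n₀ : ℕ, ∀ n ≥ n₀, ∀ Δ A B' : AtomIdx ρ n,
          IsLeftNbr f ρ c₀ n A Δ → IsRightNbr f ρ c₀ n B' Δ →
          ∀ k : ℕ, (∀ j : ℕ, 1 ≤ j → j ≤ k → ImgInAtom f ρ c₀ n j Δ) →
            crD (f^[k]) (atomL f ρ c₀ n Δ - atomLen f ρ c₀ n A) (atomL f ρ c₀ n Δ)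
              (atomR f ρ c₀ n Δ) (atomR f ρ c₀ n Δ + atomLen f ρ c₀ n B') ≤ B := by
  have h9 : 1 ≤ 9 * d ^ 2 := by nlinarith
  have hpow : (1 : ℝ) ≤ (9 * d ^ 2) ^ (3 * N) := one_le_pow₀ h9
  have h12 : (12 : ℝ) ≤ (3 / 2) ^ (2 * (3 * N + 1)) :=
    calc (12 : ℝ) ≤ (3 / 2) ^ 8 := by norm_num
      _ ≤ _ := pow_le_pow_right₀ (by norm_num) (by omega)
  refine ⟨_, by nlinarith, rfl, ?_⟩
  intro f C dc ρ c₀ ⟨hf, hrot, hirr, hρ⟩ hC hdc _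
  obtain ⟨F, hF⟩ := exists_isRotSemiconj hf.1 hrot hirr
  have hFs := hf.injective_rotSemiconj hF hirr hρ
  obtain ⟨ε, hε, B, hB, -, -, hstep, -⟩ := hf.exists_stepBound hdc
  set τ := min ε (1 / (12 * (B + 1))) with hτ
  have hτ0 : 0 < τ := lt_min hε (by positivity)
  have hexp : Real.exp (B * τ * 12) ≤ 3 := by
    have h1 : τ * (12 * (B + 1)) ≤ 1 := by
      rw [← le_div_iff₀ (by positivity)]; exact min_le_right _ _
    exact (Real.exp_le_exp.2 (show B * τ * 12 ≤ 1 by nlinarith)).trans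
      (Real.exp_one_lt_d9.le.trans (by norm_num))
  obtain ⟨η, hη, hsmall⟩ := hF.exists_forall_sub_lt hFs hτ0
  obtain ⟨n₀, hn₀⟩ := eventually_atTop.1 ((tendsto_order.1 (tendsto_convGap hirr hρ)).2
    (min 1 η / 5) (by positivity))
  have hbound : ∀ n ≥ n₀, ∀ m ≤ qden ρ (n + 1), ∀ a b c e, a < b → b < c → c < e →
      F b - F a ≤ 2 * convGap ρ n → F c - F b ≤ convGap ρ n → F e - F c ≤ 2 * convGap ρ n →
      crD f^[m] a b c e ≤ 3 * (9 * d ^ 2) ^ (3 * N) := by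
    intro n hn m hm a b c e hab hbc hce hL hM hR
    have h1 := hn₀ n hn
    have h2 := min_le_left 1 η
    have h3 := min_le_right 1 η
    refine (crD_iterate_le_of_small hf hF hFs hd hB hstep (rotSeparated_convGap hirr hρ n) hm hab
      hbc hce hL hM hR (by linarith) hτ0.le (min_le_left _ _) fun j _ => hsmall _ _ ?_).trans ?_
    · rw [hF.iterate, hF.iterate]; linarith
    · exact mul_le_mul hexp (pow_le_pow_right₀ h9 (by omega)) (by positivity) (by norm_num)
  refine ⟨n₀, fun n hn Δ A B' hA hB' k hk => ?_⟩
  have hL := hF.map_atomL_sub_leftNbr hA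
  have hR := hF.map_rightNbr_sub_atomR hB'
  have hM := hF.map_atomR_sub_map_atomL c₀ Δ
  have hbc := hF.atomL_lt_atomR hirr hρ c₀ Δ
  have hab : atomL f ρ c₀ n Δ - atomLen f ρ c₀ n A < atomL f ρ c₀ n Δ :=
    sub_lt_self _ (sub_pos.2 (hF.atomL_lt_atomR hirr hρ c₀ A))
  have hce : atomR f ρ c₀ n Δ < atomR f ρ c₀ n Δ + atomLen f ρ c₀ n B' :=
    lt_add_of_pos_right _ (sub_pos.2 (hF.atomL_lt_atomR hirr hρ c₀ B'))
  have hg := convGap_pos hirr hρ n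
  have hgA := convGap_atomGen_le hirr hρ A
  have hgB := convGap_atomGen_le hirr hρ B'
  rcases Δ with i | i
  · refine (hbound n hn k (hF.le_qden_of_imgInAtom hirr hρ i hk) _ _ _ _ hab hbc hce (by linarith)
      hM.le (by linarith)).trans ?_
    nlinarith
  · have hlong := convGap_add_le hirr hρ n
    have hA' : convGap ρ (atomGen ρ n A) = convGap ρ n := by
      rcases A with j | j
      · rfl
      · exact absurd hA.2 (hF.not_sameCirclePt_inr hirr hρ fun h => hA.1 (congrArg _ h))
    have hB'' : convGap ρ (atomGen ρ n B') = convGap ρ n := by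
      rcases B' with j | j
      · rfl
      · obtain ⟨m, hm⟩ := hB'.2
        exact absurd ⟨-m, by rw [hm]; push_cast; ring⟩
          (hF.not_sameCirclePt_inr hirr hρ (x := c₀) (i := i) (j := j)
            fun h => hB'.1 (congrArg _ h.symm))
    refine (crD_iterate_le_of_long_sides (n := n + 1) hf.1 hF hFs hirr hρ hbc
      (fun m hm a e ha he h1 h2 => hbound (n + 1) (by omega) m hm a _ _ e ha hbc he h1 hM.le h2)
      (atom_eq_retPt hf.1 hF hirr hρ c₀ (Sum.inr i)) (by linarith) (by linarith) k).trans ?_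
    nlinarith
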